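/- arXiv:2402.01447 — 5 statements merged into one kernel-verified Lean document; each statement's English description precedes it below -/
import Mathlib

section
/- There exists ε > 0 such that for every n, every real p with 0 < p < 1, and every natural number d ≥ 1 the following holds: if G is an n-vertex (p,β)-jumbled simple graph with minimum degree δ(G) ≥ (1−ε)np, where β ≤ ε·np/d, then G is (n/(3d), d)-expanding, i.e., every vertex set S with |S| ≤ n/(3d) satisfies |N_G(S)| ≥ d·|S|. -/
open SimpleGraph

/-- The number of edges of `G` with both endpoints inside `U`. -/
noncomputable def interiorEdgeCount {V : Type} (G : SimpleGraph V) (U : Set V) : ℕ :=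
  {e ∈ G.edgeSet | ∀ v ∈ e, v ∈ U}.ncard

/-- `G` is `(p, β)`-jumbled: `0 < p < 1 ≤ β` and for every vertex subset `U`,
`|e_G(U) - p * binom(|U|, 2)| ≤ β * |U|`. -/
def IsJumbled {V : Type} (G : SimpleGraph V) (p β : ℝ) : Prop :=
  0 < p ∧ p < 1 ∧ 1 ≤ β ∧
    ∀ U : Set V,
      |(interiorEdgeCount G U : ℝ) - p * (Nat.choose U.ncard 2 : ℕ)| ≤ β * U.ncard

/-- The external neighbourhood of a vertex set: vertices outside `S` with a neighbour in `S`. -/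
def setNeighbors {V : Type} (G : SimpleGraph V) (S : Set V) : Set V :=
  {x | x ∉ S ∧ ∃ s ∈ S, G.Adj s x}

open scoped Classical in
/-- The number of ordered pairs in `X ×ˢ Y` that are adjacent in `G`. -/
noncomputable def adjPairCount {V : Type} (G : SimpleGraph V) (X Y : Finset V) : ℕ :=
  ∑ x ∈ X, ∑ y ∈ Y, if G.Adj x y then 1 else 0

open scoped Classical in
theorem adjPairCount_comm {V : Type} (G : SimpleGraph V) (X Y : Finset V) :
    adjPairCount G X Y = adjPairCount G Y X := by
  unfold adjPairCount
  rw [Finset.sum_comm]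
  simp only [G.adj_comm]

open scoped Classical in
theorem adjPairCount_union_left {V : Type} (G : SimpleGraph V) {X Y : Finset V}
    (h : Disjoint X Y) (Z : Finset V) :
    adjPairCount G (X ∪ Y) Z = adjPairCount G X Z + adjPairCount G Y Z := by
  simp only [adjPairCount, Finset.sum_union h]

open scoped Classical in
theorem adjPairCount_union_right {V : Type} (G : SimpleGraph V) {X Y : Finset V}
    (h : Disjoint X Y) (Z : Finset V) :
    adjPairCount G Z (X ∪ Y) = adjPairCount G Z X + adjPairCount G Z Y := by
  simp only [adjPairCount_comm G Z, adjPairCount_union_left G h]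

open scoped Classical in
theorem two_mul_interiorEdgeCount {V : Type} [Fintype V] (G : SimpleGraph V) (X : Finset V) :
    2 * interiorEdgeCount G (X : Set V) = adjPairCount G X X := by
  let H : SimpleGraph V :=
    { Adj := fun x y => G.Adj x y ∧ x ∈ X ∧ y ∈ X
      symm := ⟨fun x y h => ⟨h.1.symm, h.2.2, h.2.1⟩⟩
      loopless := ⟨fun x h => G.loopless.irrefl x h.1⟩ }
  have hE : {e ∈ G.edgeSet | ∀ v ∈ e, v ∈ (X : Set V)} = (H.edgeFinset : Set (Sym2 V)) := by
    ext e
    induction e with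
    | h x y => simp [H]
  have hdeg : ∀ x, H.degree x = ∑ y, if H.Adj x y then 1 else 0 := fun x => by
    rw [← SimpleGraph.card_neighborFinset_eq_degree, SimpleGraph.neighborFinset_eq_filter,
      Finset.card_filter]
  rw [interiorEdgeCount, hE, Set.ncard_coe_finset, ← H.sum_degrees_eq_twice_card_edges,
    adjPairCount]
  simp only [hdeg]
  rw [← Finset.sum_subset (Finset.subset_univ X)]
  · refine Finset.sum_congr rfl fun x hx => ?_
    rw [← Finset.sum_subset (Finset.subset_univ X)]
    · exact Finset.sum_congr rfl fun y hy => by simp [H, hx, hy]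
    · intro y _ hy
      simp [H, hy]
  · intro x _ hx
    simp [H, hx]

open scoped Classical in
theorem sum_ncard_neighborSet_eq_adjPairCount {V : Type} [Fintype V] (G : SimpleGraph V)
    {S U : Finset V} (h : ∀ s ∈ S, ∀ x, G.Adj s x → x ∈ U) :
    ∑ s ∈ S, (G.neighborSet s).ncard = adjPairCount G S U := by
  refine Finset.sum_congr rfl fun s hs => ?_
  have hU : G.neighborSet s = ((U.filter fun y => G.Adj s y : Finset V) : Set V) := by
    ext y
    simpa using h s hs y
  rw [hU, Set.ncard_coe_finset, Finset.card_filter]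

/-- In a jumbled graph, the degree sum over `S` is bounded in terms of the sizes of `S` and of
its external neighbourhood. -/
theorem IsJumbled.sum_ncard_neighborSet_le {V : Type} [Fintype V] {G : SimpleGraph V} {p β : ℝ}
    (hG : IsJumbled G p β) {S T : Finset V} (hT : setNeighbors G S = T) :
    ∑ s ∈ S, ((G.neighborSet s).ncard : ℝ) ≤
      p * S.card * (S.card + T.card - 1) + 2 * β * (S.card + T.card) := by
  classical
  have hmem : ∀ x, x ∈ T ↔ x ∉ S ∧ ∃ s ∈ S, G.Adj s x := fun x => by
    rw [← Finset.mem_coe, ← hT]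
    simp [setNeighbors]
  have hdisj : Disjoint S T :=
    Finset.disjoint_left.2 fun x hx hxT => ((hmem x).1 hxT).1 hx
  have hsum := sum_ncard_neighborSet_eq_adjPairCount G (S := S) (U := S ∪ T) fun s hs x hx => by
    by_cases hxS : x ∈ S
    · exact Finset.mem_union_left _ hxS
    · exact Finset.mem_union_right _ ((hmem x).2 ⟨hxS, s, hs, hx⟩)
  have hcount : ∑ s ∈ S, (G.neighborSet s).ncard + interiorEdgeCount G (T : Set V) =
      interiorEdgeCount G ((S ∪ T : Finset V) : Set V) + interiorEdgeCount G (S : Set V) := by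
    have hS := two_mul_interiorEdgeCount G S
    have hT' := two_mul_interiorEdgeCount G T
    have hU := two_mul_interiorEdgeCount G (S ∪ T)
    have hST := adjPairCount_comm G S T
    rw [adjPairCount_union_left G hdisj] at hU
    simp only [adjPairCount_union_right G hdisj] at hU hsum
    lia
  have hcount' : ∑ s ∈ S, ((G.neighborSet s).ncard : ℝ) + interiorEdgeCount G (T : Set V) =
      interiorEdgeCount G ((S ∪ T : Finset V) : Set V) + interiorEdgeCount G (S : Set V) := by
    exact_mod_cast hcount
  have jS := (abs_le.1 (hG.2.2.2 S)).2
  have jT := (abs_le.1 (hG.2.2.2 T)).1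
  have jU := (abs_le.1 (hG.2.2.2 (S ∪ T : Finset V))).2
  simp only [Set.ncard_coe_finset, Finset.card_union_of_disjoint hdisj, Nat.cast_choose_two,
    Nat.cast_add] at jS jT jU
  linarith

theorem jumbled_expanding :
    ∃ ε : ℝ, ε > 0 ∧ ∀ (n : ℕ) (p : ℝ), 0 < p → p < 1 → ∀ d : ℕ, 1 ≤ d →
      ∀ (V : Type) [Fintype V] [DecidableEq V] (G : SimpleGraph V) (β : ℝ),
        Fintype.card V = n →
        IsJumbled G p β → β ≤ ε * n * p / d →
        (∀ v : V, ((G.neighborSet v).ncard : ℝ) ≥ (1 - ε) * n * p) →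
        ∀ S : Set V, (S.ncard : ℝ) ≤ n / (3 * d) →
          ((setNeighbors G S).ncard : ℝ) ≥ d * S.ncard := by
  refine ⟨1 / 16, by norm_num, ?_⟩
  intro n p hp hp1 d hd V _ _ G β _ hG hβ hdeg S hS
  classical
  by_contra! hlt
  obtain ⟨A, rfl⟩ := S.toFinite.exists_finset_coe
  obtain ⟨T, hT⟩ := (setNeighbors G (A : Set V)).toFinite.exists_finset_coe
  rw [← hT] at hlt
  simp only [Set.ncard_coe_finset] at hlt hS
  have hupper := hG.sum_ncard_neighborSet_le hT.symm
  have hlower : (A.card : ℝ) * ((1 - 1 / 16) * n * p) ≤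
      ∑ s ∈ A, ((G.neighborSet s).ncard : ℝ) := by
    rw [← nsmul_eq_mul]
    exact Finset.card_nsmul_le_sum _ _ _ fun s _ => hdeg s
  have hd1 : (1 : ℝ) ≤ d := by exact_mod_cast hd
  have hd0 : (0 : ℝ) < d := by linarith
  have hs : (0 : ℝ) < A.card :=
    pos_of_mul_pos_right ((Nat.cast_nonneg T.card).trans_lt hlt) hd0.le
  have hβ1 : 1 ≤ β := hG.2.2.1
  rw [le_div_iff₀ (by positivity)] at hS
  rw [le_div_iff₀ hd0] at hβ
  have hn : (0 : ℝ) < n := by nlinarith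
  have hsize : (A.card + T.card : ℝ) ≤ 2 * d * A.card := by nlinarith
  have hfirst : p * A.card * (A.card + T.card - 1 : ℝ) ≤ p * A.card * (2 / 3 * n) := by
    gcongr
    linarith
  have hsecond : 2 * β * (A.card + T.card : ℝ) ≤ A.card * (1 / 4 * n * p) := by
    calc 2 * β * (A.card + T.card : ℝ) ≤ 2 * β * (2 * d * A.card) := by gcongr
      _ = 4 * A.card * (β * d) := by ring
      _ ≤ 4 * A.card * (1 / 16 * n * p) := by gcongr
      _ = A.card * (1 / 4 * n * p) := by ring
  have hpos : 0 < (A.card : ℝ) * n * p := by positivity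
  linarith
end

section
/- There exist ε > 0, C > 1 and a natural number N such that for every n ≥ N the following holds. Let G be an n-vertex (p,β)-jumbled simple graph with δ(G) ≥ (1−ε)np, where p ≥ C·log(n)/n and β ≤ ε·np, let R ⊆ E(G) satisfy e_R(A,B) ≥ e_G(A,B)/2 for every partition V(G) = A ∪ B, and let S be a vertex set with |S| ≤ 2·log(n). Then for every vertex x ∉ S, the number of vertices of V(G) ∖ S reachable from x by a path of length at most log(n)/log(10) + 7 using only edges of R and avoiding S is greater than n/2. -/
open SimpleGraph

/-- The number of edges in the edge set `E` with one endpoint in `A` and the other in `B`. -/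
noncomputable def edgeCountBetween {V : Type} (E : Set (Sym2 V)) (A B : Set V) : ℕ :=
  {e ∈ E | ∃ a ∈ A, ∃ b ∈ B, e = s(a, b)}.ncard

lemma sum_degree_le {V : Type} [Fintype V] (G : SimpleGraph V) (A : Finset V) :
    ∑ a ∈ A, (G.neighborSet a).ncard ≤
      2 * interiorEdgeCount G A + edgeCountBetween G.edgeSet A (A : Set V)ᶜ := by
  classical
  have hsum : ∑ a ∈ A, (G.neighborSet a).ncard
      = (A.sigma fun a => G.neighborFinset a).card := by
    rw [Finset.card_sigma]
    refine Finset.sum_congr rfl fun a _ => ?_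
    rw [Set.ncard_eq_toFinset_card', neighborFinset]
  rw [hsum, ← Finset.card_filter_add_card_filter_not (fun q : Σ _ : V, V => q.2 ∈ A)]
  let f : (Σ _ : V, V) → Sym2 V := fun q => s(q.1, q.2)
  refine add_le_add ?_ ?_
  · refine (Finset.card_le_mul_card_image (f := f) _ 2 ?_).trans ?_
    · intro e he
      obtain ⟨⟨u, v⟩, -, rfl⟩ := Finset.mem_image.1 he
      refine (Finset.card_le_card (t := {⟨u, v⟩, ⟨v, u⟩}) ?_).trans Finset.card_le_two
      rintro ⟨u', v'⟩ h
      have h' := (Finset.mem_filter.1 h).2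
      simp only [f, Sym2.eq_iff] at h'
      rcases h' with ⟨rfl, rfl⟩ | ⟨rfl, rfl⟩ <;> simp
    · refine Nat.mul_le_mul_left 2 ?_
      rw [← Set.ncard_coe_finset]
      refine Set.ncard_le_ncard ?_ (Set.toFinite _)
      intro e he
      obtain ⟨⟨u, v⟩, h, rfl⟩ := Finset.mem_image.1 he
      simp only [Finset.mem_filter, Finset.mem_sigma, mem_neighborFinset] at h
      simp only [f, Set.mem_ofPred_eq, mem_edgeSet, Sym2.mem_iff, Finset.mem_coe]
      refine ⟨h.1.2, ?_⟩
      rintro w (rfl | rfl)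
      exacts [h.1.1, h.2]
  · rw [← Finset.card_image_of_injOn (f := f), ← Set.ncard_coe_finset]
    · refine Set.ncard_le_ncard ?_ (Set.toFinite _)
      intro e he
      obtain ⟨⟨u, v⟩, h, rfl⟩ := Finset.mem_image.1 he
      simp only [Finset.mem_filter, Finset.mem_sigma, mem_neighborFinset] at h
      exact ⟨h.1.2, u, h.1.1, v, h.2, rfl⟩
    · rintro ⟨u, v⟩ h ⟨u', v'⟩ h' he
      simp only [Finset.coe_filter, Finset.mem_sigma, mem_neighborFinset, Set.mem_ofPred_eq]
        at h h'
      simp only [f, Sym2.eq_iff] at he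
      rcases he with ⟨rfl, rfl⟩ | ⟨rfl, rfl⟩
      · rfl
      · exact absurd h.1.1 h'.2

lemma interior_add_interior_add_between_le {V : Type} [Fintype V] (G : SimpleGraph V)
    {A B : Set V} (h : Disjoint A B) :
    interiorEdgeCount G A + interiorEdgeCount G B + edgeCountBetween G.edgeSet A B
      ≤ interiorEdgeCount G (A ∪ B) := by
  unfold interiorEdgeCount edgeCountBetween
  have hAB : ∀ v, v ∈ A → v ∈ B → False := fun v ha hb => Set.disjoint_left.1 h ha hb
  rw [← Set.ncard_union_eq _ (Set.toFinite _) (Set.toFinite _),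
    ← Set.ncard_union_eq _ (Set.toFinite _) (Set.toFinite _)]
  · refine Set.ncard_le_ncard ?_ (Set.toFinite _)
    rintro e ((⟨he, h⟩ | ⟨he, h⟩) | ⟨he, a, ha, b, hb, rfl⟩)
    · exact ⟨he, fun v hv => Or.inl (h v hv)⟩
    · exact ⟨he, fun v hv => Or.inr (h v hv)⟩
    · refine ⟨he, fun v hv => ?_⟩
      rcases Sym2.mem_iff.1 hv with rfl | rfl
      exacts [Or.inl ha, Or.inr hb]
  · rw [Set.disjoint_left]
    rintro e (⟨he, h⟩ | ⟨he, h⟩) ⟨-, a, ha, b, hb, rfl⟩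
    · exact hAB b (h b (Sym2.mem_mk_right a b)) hb
    · exact hAB a ha (h a (Sym2.mem_mk_left a b))
  · rw [Set.disjoint_left]
    rintro e ⟨he, h⟩ ⟨-, h'⟩
    induction e with
    | _ a b => exact hAB a (h a (Sym2.mem_mk_left a b)) (h' a (Sym2.mem_mk_left a b))

lemma edgeCountBetween_le_mul {V : Type} [Fintype V] (E : Set (Sym2 V)) (A B : Set V) :
    edgeCountBetween E A B ≤ A.ncard * B.ncard := by
  rw [← Set.ncard_prod]
  refine le_trans (Set.ncard_le_ncard (t := (fun q : V × V => s(q.1, q.2)) '' A ×ˢ B) ?_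
    (Set.toFinite _)) (Set.ncard_image_le (Set.toFinite _))
  rintro e ⟨-, a, ha, b, hb, rfl⟩
  exact ⟨(a, b), ⟨ha, hb⟩, rfl⟩

lemma edgeCountBetween_le_add {V : Type} [Fintype V] {E E' : Set (Sym2 V)} {A B C D : Set V}
    (hE : E ⊆ E') (h : ∀ a ∈ A, ∀ b ∈ B, s(a, b) ∈ E → b ∈ C ∪ D) :
    edgeCountBetween E A B ≤ edgeCountBetween E' A C + edgeCountBetween E' A D := by
  refine le_trans (Set.ncard_le_ncard ?_ (Set.toFinite _)) (Set.ncard_union_le _ _)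
  rintro e ⟨he, a, ha, b, hb, rfl⟩
  rcases h a ha b hb he with hc | hd
  · exact Or.inl ⟨hE he, a, ha, b, hc, rfl⟩
  · exact Or.inr ⟨hE he, a, ha, b, hd, rfl⟩

lemma IsJumbled.edgeCountBetween_le {V : Type} [Fintype V] {G : SimpleGraph V} {p β : ℝ}
    (hG : IsJumbled G p β) {A B : Set V} (h : Disjoint A B) :
    (edgeCountBetween G.edgeSet A B : ℝ)
      ≤ p * A.ncard * B.ncard + 2 * β * (A.ncard + B.ncard) := by
  obtain ⟨-, -, -, hU⟩ := hG
  have h1 := (abs_le.1 (hU A)).1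
  have h2 := (abs_le.1 (hU B)).1
  have h3 := (abs_le.1 (hU (A ∪ B))).2
  have h4 : (interiorEdgeCount G A : ℝ) + interiorEdgeCount G B + edgeCountBetween G.edgeSet A B
      ≤ interiorEdgeCount G (A ∪ B) := by
    exact_mod_cast interior_add_interior_add_between_le G h
  rw [Set.ncard_union_eq h (Set.toFinite _) (Set.toFinite _)] at h3
  simp only [Nat.cast_choose_two] at h1 h2 h3
  push_cast at h3
  linarith

/-- One step of neighbourhood growth in the subgraph `R` avoiding `S`. -/
lemma IsJumbled.expansion {V : Type} [Fintype V] {G : SimpleGraph V} {p β n : ℝ}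
    (hG : IsJumbled G p β) (hn0 : 0 < n) (hβ : β ≤ 1 / 10000 * n * p)
    (hdeg : ∀ v : V, ((G.neighborSet v).ncard : ℝ) ≥ (1 - 1 / 10000) * n * p)
    {R : Set (Sym2 V)} (hR : R ⊆ G.edgeSet)
    (hcut : ∀ A B : Set V, A ∪ B = Set.univ → Disjoint A B →
      (edgeCountBetween R A B : ℝ) ≥ (edgeCountBetween G.edgeSet A B : ℝ) / 2)
    {S : Set V} (hS : (S.ncard : ℝ) ≤ 2 / 1000 * (n * p)) {A M : Set V} (hAM : Disjoint A M)
    (hM : ∀ a ∈ A, ∀ b ∈ Aᶜ, s(a, b) ∈ R → b ∈ M ∪ S) :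
    497 / 1000 * n * A.ncard - (A.ncard : ℝ) ^ 2 / 2
      ≤ M.ncard * (A.ncard + n / 5000) := by
  classical
  have hp := hG.1
  have h1 := hcut A Aᶜ (Set.union_compl_self A) disjoint_compl_right
  have h2 : (edgeCountBetween R A Aᶜ : ℝ)
      ≤ edgeCountBetween G.edgeSet A M + edgeCountBetween G.edgeSet A S := by
    exact_mod_cast edgeCountBetween_le_add hR hM
  have h3 := hG.edgeCountBetween_le hAM
  have h4 : (edgeCountBetween G.edgeSet A S : ℝ) ≤ A.ncard * S.ncard := by
    exact_mod_cast edgeCountBetween_le_mul G.edgeSet A S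
  have h5 : (A.ncard : ℝ) * ((1 - 1 / 10000) * n * p)
      ≤ 2 * interiorEdgeCount G A + edgeCountBetween G.edgeSet A Aᶜ := by
    have h := sum_degree_le G A.toFinset
    rw [Set.coe_toFinset] at h
    have h' : ((∑ a ∈ A.toFinset, (G.neighborSet a).ncard : ℕ) : ℝ)
        ≤ 2 * interiorEdgeCount G A + edgeCountBetween G.edgeSet A Aᶜ := by exact_mod_cast h
    refine le_trans ?_ h'
    rw [Set.ncard_eq_toFinset_card', ← nsmul_eq_mul]
    push_cast
    exact Finset.card_nsmul_le_sum _ _ _ fun a _ => hdeg a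
  have h6 := (abs_le.1 (hG.2.2.2 A)).2
  rw [Nat.cast_choose_two] at h6
  set a : ℝ := (A.ncard : ℝ)
  set m : ℝ := (M.ncard : ℝ)
  have ha : 0 ≤ a := Nat.cast_nonneg _
  have hm : 0 ≤ m := Nat.cast_nonneg _
  have h7 : a * S.ncard ≤ a * (2 / 1000 * (n * p)) := by gcongr
  have h8 : β * a ≤ 1 / 10000 * n * p * a := by gcongr
  have h9 : β * m ≤ 1 / 10000 * n * p * m := by gcongr
  have h10 : 0 ≤ n * p * a := by positivity
  have h11 : 0 ≤ p * a := by positivity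
  refine le_of_mul_le_mul_left ?_ hp
  linarith

/-- The vertices reachable from `x` in at most `k` steps along `R` avoiding `S`. -/
def reachWithin {V : Type} (R : Set (Sym2 V)) (S : Set V) (x : V) : ℕ → Set V
  | 0 => {x}
  | k + 1 => reachWithin R S x k ∪ {v | v ∉ S ∧ ∃ u ∈ reachWithin R S x k, s(u, v) ∈ R}

lemma exists_path_of_mem_reachWithin {V : Type} {G : SimpleGraph V} {R : Set (Sym2 V)}
    (hR : R ⊆ G.edgeSet) {S : Set V} {x : V} (hx : x ∉ S) (k : ℕ) {y : V}
    (hy : y ∈ reachWithin R S x k) :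
    ∃ q : G.Walk x y, q.IsPath ∧ (∀ e ∈ q.edges, e ∈ R) ∧ (∀ u ∈ q.support, u ∉ S) ∧
      q.length ≤ k := by
  classical
  suffices h : ∃ q : G.Walk x y, (∀ e ∈ q.edges, e ∈ R) ∧ (∀ u ∈ q.support, u ∉ S) ∧
      q.length ≤ k by
    obtain ⟨q, h1, h2, h3⟩ := h
    exact ⟨q.bypass, q.bypass_isPath, fun e he => h1 e (q.edges_bypass_subset_edges he),
      fun u hu => h2 u (q.support_bypass_subset_support hu), q.length_bypass_le_length.trans h3⟩
  induction k generalizing y with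
  | zero =>
    obtain rfl : y = x := hy
    exact ⟨Walk.nil, by simp, by simpa using hx, by simp⟩
  | succ k ih =>
    rcases hy with hy | ⟨hyS, u, hu, huy⟩
    · obtain ⟨q, h1, h2, h3⟩ := ih hy
      exact ⟨q, h1, h2, by omega⟩
    · obtain ⟨q, h1, h2, h3⟩ := ih hu
      have hadj : G.Adj u y := hR huy
      refine ⟨q.concat hadj, ?_, ?_, by simpa using h3⟩
      · intro e he
        simp only [Walk.edges_concat, List.concat_eq_append, List.mem_append,
          List.mem_singleton] at he
        rcases he with he | rfl
        exacts [h1 e he, huy]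
      · intro w hw
        simp only [Walk.support_concat, List.mem_append,
          List.mem_singleton] at hw
        rcases hw with hw | rfl
        exacts [h2 w hw, hyS]

/-- A sequence that grows by a factor `10` up to `n / 20` and then exceeds `n / 2` in a single
step is larger than `n / 2` after `log₁₀ n + 2` steps. -/
lemma half_lt_of_growth {n : ℝ} (hn : 1 ≤ n) {f : ℕ → ℝ} (hmono : Monotone f) (h0 : 1 ≤ f 0)
    (hsmall : ∀ k, f k ≤ n / 20 → 10 * f k ≤ f (k + 1))
    (hlarge : ∀ k, n / 20 < f k → f k ≤ n / 2 → n / 2 < f (k + 1)) :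
    n / 2 < f (⌊Real.log n / Real.log 10⌋₊ + 2) := by
  have hpow : ∀ k, n / 20 < f k ∨ 10 ^ k ≤ f k := by
    intro k
    induction k with
    | zero => right; simpa using h0
    | succ k ih =>
      by_cases h : n / 20 < f k
      · exact Or.inl (h.trans_le (hmono k.le_succ))
      · right
        have h1 := hsmall k (not_lt.1 h)
        have h2 := ih.resolve_left h
        rw [pow_succ]
        linarith
  set k := ⌊Real.log n / Real.log 10⌋₊
  have hlog : 0 < Real.log 10 := Real.log_pos (by norm_num)
  have hk : n < 10 ^ (k + 1) := by
    have h := Nat.lt_floor_add_one (Real.log n / Real.log 10)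
    rw [div_lt_iff₀ hlog] at h
    rw [← Real.log_lt_log_iff (by linarith) (by positivity), Real.log_pow]
    push_cast
    exact h
  have hk' : n / 20 < f (k + 1) := by
    rcases hpow (k + 1) with h | h
    · exact h
    · linarith
  by_cases h : f (k + 1) ≤ n / 2
  · exact hlarge _ hk' h
  · exact (not_le.1 h).trans_le (hmono (k + 1).le_succ)

theorem expansion_to_half :
    ∃ ε C : ℝ, ε > 0 ∧ C > 1 ∧ ∃ N : ℕ, ∀ n : ℕ, n ≥ N →
      ∀ (V : Type) [Fintype V] [DecidableEq V] (G : SimpleGraph V) (p β : ℝ),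
        Fintype.card V = n →
        p ≥ C * Real.log n / n → β ≤ ε * n * p →
        IsJumbled G p β →
        (∀ v : V, ((G.neighborSet v).ncard : ℝ) ≥ (1 - ε) * n * p) →
        ∀ R : Set (Sym2 V), R ⊆ G.edgeSet →
        (∀ A B : Set V, A ∪ B = Set.univ → Disjoint A B →
          (edgeCountBetween R A B : ℝ) ≥ (edgeCountBetween G.edgeSet A B : ℝ) / 2) →
        ∀ S : Set V, (S.ncard : ℝ) ≤ 2 * Real.log n →
        ∀ x, x ∉ S →
          ({y : V | y ∉ S ∧ ∃ q : G.Walk x y, q.IsPath ∧ (∀ e ∈ q.edges, e ∈ R) ∧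
              (∀ u ∈ q.support, u ∉ S) ∧
              (q.length : ℝ) ≤ Real.log n / Real.log 10 + 7}.ncard : ℝ) > n / 2 := by
  refine ⟨1 / 10000, 1000, by norm_num, by norm_num, 1, ?_⟩
  intro n hn V _ _ G p β _ hp hβ hG hdeg R hR hcut S hS x hx
  have hn1 : (1 : ℝ) ≤ n := by exact_mod_cast hn
  have hn0 : (0 : ℝ) < n := by linarith
  have hS' : (S.ncard : ℝ) ≤ 2 / 1000 * (n * p) := by
    rw [ge_iff_le, div_le_iff₀ hn0] at hp
    linarith
  let A := reachWithin R S x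
  let M : ℕ → Set V := fun k => A (k + 1) \ A k
  have hsub : ∀ k, A k ⊆ A (k + 1) := fun k => Set.subset_union_left
  have hcardA : ∀ k, ((A (k + 1)).ncard : ℝ) = (A k).ncard + (M k).ncard := by
    intro k
    have h := Set.ncard_sdiff_add_ncard_of_subset (hsub k)
    rw [← h]
    push_cast
    exact add_comm _ _
  have hexp : ∀ k, 497 / 1000 * (n : ℝ) * (A k).ncard - ((A k).ncard : ℝ) ^ 2 / 2
      ≤ (M k).ncard * ((A k).ncard + (n : ℝ) / 5000) := by
    intro k
    refine hG.expansion hn0 hβ hdeg hR hcut hS' disjoint_sdiff_self_right ?_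
    intro a ha b hb hab
    by_cases hbS : b ∈ S
    · exact Or.inr hbS
    · exact Or.inl ⟨Or.inr ⟨hbS, a, ha, hab⟩, hb⟩
  have hmono : Monotone fun k => ((A k).ncard : ℝ) :=
    monotone_nat_of_le_succ fun k => by
      exact_mod_cast Set.ncard_le_ncard (hsub k) (Set.toFinite _)
  have h0 : (1 : ℝ) ≤ (A 0).ncard := by simp [A, reachWithin]
  have hpos : ∀ k, (1 : ℝ) ≤ (A k).ncard := fun k => h0.trans (hmono k.zero_le)
  have hhalf := half_lt_of_growth hn1 hmono h0 ?_ ?_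
  · refine gt_iff_lt.2 (hhalf.trans_le ?_)
    norm_cast
    refine Set.ncard_le_ncard ?_ (Set.toFinite _)
    intro y hy
    obtain ⟨q, h1, h2, h3, h4⟩ := exists_path_of_mem_reachWithin hR hx _ hy
    refine ⟨h3 y q.end_mem_support, q, h1, h2, h3, ?_⟩
    have hfloor := Nat.floor_le (div_nonneg (Real.log_nonneg hn1)
      (Real.log_nonneg (by norm_num : (1 : ℝ) ≤ 10)))
    have h4' : (q.length : ℝ) ≤ ⌊Real.log n / Real.log 10⌋₊ + 2 := by exact_mod_cast h4
    linarith
  · intro k hk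
    have h := hexp k
    have ha := hpos k
    rw [hcardA]
    generalize ((A k).ncard : ℝ) = a at *
    generalize ((M k).ncard : ℝ) = m at *
    by_contra hlt
    have hm : m ≤ 9 * a := by linarith
    have h1 : m * (a + (n : ℝ) / 5000) ≤ 9 * a * (a + (n : ℝ) / 5000) := by gcongr
    nlinarith [mul_le_mul_of_nonneg_left hk (by linarith : 0 ≤ a),
      mul_pos (by linarith : 0 < a) hn0]
  · intro k hk hk2
    have h := hexp k
    have ha := hpos k
    rw [hcardA]
    generalize ((A k).ncard : ℝ) = a at *
    generalize ((M k).ncard : ℝ) = m at *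
    by_contra hlt
    have hm : m ≤ n / 2 - a := by linarith
    have h1 : m * (a + (n : ℝ) / 5000) ≤ (n / 2 - a) * (a + (n : ℝ) / 5000) := by gcongr
    nlinarith [mul_lt_mul_of_pos_left hk (by linarith : 0 < a), mul_lt_mul_of_pos_left hk hn0,
      mul_pos hn0 hn0]
end

section
/- Let G be an n-vertex (p,β)-jumbled simple graph with 0 < p < 1 ≤ β, and suppose A and B are disjoint vertex subsets with |A| = |B| = k such that there is no edge of G between A and B. Then p·k ≤ 4β. -/
open SimpleGraph

/-- If no edge joins `A` to `B`, every edge inside `A ∪ B` lies inside `A` or inside `B`. -/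
theorem interiorEdgeCount_union_le {V : Type} [Finite V] (G : SimpleGraph V) (A B : Set V)
    (hno : ∀ a ∈ A, ∀ b ∈ B, ¬ G.Adj a b) :
    interiorEdgeCount G (A ∪ B) ≤ interiorEdgeCount G A + interiorEdgeCount G B := by
  unfold interiorEdgeCount
  refine (Set.ncard_le_ncard ?_ (Set.toFinite _)).trans (Set.ncard_union_le _ _)
  rintro e ⟨he, hU⟩
  induction e using Sym2.ind with
  | _ x y =>
    have hxy : G.Adj x y := he
    have hx := hU x (Sym2.mem_mk_left x y)
    have hy := hU y (Sym2.mem_mk_right x y)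
    simp only [Set.mem_union, Set.mem_ofPred_eq, Sym2.mem_iff, forall_eq_or_imp, forall_eq,
      SimpleGraph.mem_edgeSet] at hx hy ⊢
    have h₁ := hno x
    have h₂ := hno y
    have h₃ := hxy.symm
    grind

theorem no_edge_between_equal_sets {V : Type} [Fintype V] [DecidableEq V]
    (G : SimpleGraph V) (p β : ℝ) (hJ : IsJumbled G p β)
    (A B : Set V) (k : ℕ) (hAB : Disjoint A B)
    (hA : A.ncard = k) (hB : B.ncard = k)
    (hno : ∀ a ∈ A, ∀ b ∈ B, ¬ G.Adj a b) :
    p * k ≤ 4 * β := by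
  obtain ⟨-, -, hβ, hU⟩ := hJ
  rcases Nat.eq_zero_or_pos k with rfl | hk
  · simp only [Nat.cast_zero, mul_zero]
    linarith
  have hk' : (0 : ℝ) < k := by exact_mod_cast hk
  have hcard : (A ∪ B).ncard = 2 * k := by
    rw [Set.ncard_union_eq hAB (Set.toFinite _) (Set.toFinite _), hA, hB, two_mul]
  have hle : (interiorEdgeCount G (A ∪ B) : ℝ) ≤
      interiorEdgeCount G A + interiorEdgeCount G B := by
    exact_mod_cast interiorEdgeCount_union_le G A B hno
  have hUnion := (abs_le.mp (hU (A ∪ B))).1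
  have hUA := (abs_le.mp (hU A)).2
  have hUB := (abs_le.mp (hU B)).2
  rw [hcard, Nat.cast_choose_two] at hUnion
  rw [hA, Nat.cast_choose_two] at hUA
  rw [hB, Nat.cast_choose_two] at hUB
  push_cast at hUnion
  refine le_of_mul_le_mul_right ?_ hk'
  linarith
end

section
/- There exist ε > 0, C > 1 and a natural number N such that for every n ≥ N the following holds. Let G be a simple graph on n vertices satisfying, for some real p ≥ C·log(n)/n: (1) δ(G) ≥ (1−ε)np; (2) G is (p,β)-jumbled for some β with 1 ≤ β ≤ ε·np/log(log n); (3) there is an edge of G between every two disjoint vertex subsets A, B with |A|, |B| ≥ ε·n·log(log n)/log n. Then G contains a Hamilton cycle. -/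
open SimpleGraph

section Lists

variable {V : Type*}

/-- The list `I` occurs in `l` as a contiguous block, possibly traversed backwards. -/
def Unbroken (I l : List V) : Prop := I <:+: l ∨ I.reverse <:+: l

lemma infix_of_infix_append_cons {I A B : List V} {v : V} (h : I <:+: A ++ v :: B) (hv : v ∉ I) :
    I <:+: A ∨ I <:+: B := by
  rw [List.infix_append_iff] at h
  rcases h with h | h | ⟨I₁, I₂, rfl, h₁, h₂⟩
  · exact Or.inl h
  · rw [List.infix_cons_iff] at h
    rcases h with h | h
    · rw [List.prefix_cons_iff] at h
      rcases h with rfl | ⟨t, rfl, -⟩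
      · exact Or.inl (List.nil_infix)
      · simp at hv
    · exact Or.inr h
  · rw [List.prefix_cons_iff] at h₂
    rcases h₂ with rfl | ⟨t, rfl, -⟩
    · exact Or.inl (by simpa using h₁.isInfix)
    · simp at hv

lemma Unbroken.of_append_cons {I A B : List V} {v : V} (h : Unbroken I (A ++ v :: B))
    (hv : v ∉ I) : Unbroken I A ∨ Unbroken I B := by
  rcases h with h | h
  · rcases infix_of_infix_append_cons h hv with h | h
    · exact Or.inl (Or.inl h)
    · exact Or.inr (Or.inl h)
  · rcases infix_of_infix_append_cons h (by simpa using hv) with h | h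
    · exact Or.inl (Or.inr h)
    · exact Or.inr (Or.inr h)

lemma unbroken_reverse_right {I l : List V} : Unbroken I l.reverse ↔ Unbroken I l := by
  unfold Unbroken
  rw [← List.reverse_infix (l₁ := I.reverse), ← List.reverse_infix (l₁ := I)]
  simp [or_comm]

lemma Unbroken.mono {I A l : List V} (h : Unbroken I A) (hA : A <:+: l) : Unbroken I l :=
  h.imp (fun h => h.trans hA) (fun h => h.trans hA)

lemma Unbroken.of_infix_block {I J l : List V} (h : Unbroken I l) (hJ : J <:+: I) : Unbroken J l :=
  h.imp (fun h => hJ.trans h) (fun h => (List.reverse_infix.2 hJ).trans h)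

lemma Unbroken.subset {I l : List V} (h : Unbroken I l) : I ⊆ l := by
  rcases h with h | h
  · exact h.subset
  · intro x hx
    exact h.subset (by simpa using hx)

lemma Unbroken.rotate {I p q : List V} {x : V} (h : Unbroken I (p ++ x :: q)) (hx : x ∉ I) :
    Unbroken I (x :: (p.reverse ++ q)) := by
  rcases h.of_append_cons hx with h | h
  · exact (unbroken_reverse_right.2 h).mono ⟨[x], q, by simp⟩
  · exact h.mono ⟨x :: p.reverse, [], by simp⟩

/-- In a list without repetitions, an element has at most one predecessor. -/
lemma pair_infix_left_unique {l : List V} (hl : l.Nodup) {x x' y : V} (h : [x, y] <:+: l)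
    (h' : [x', y] <:+: l) : x = x' := by
  obtain ⟨s, t, rfl⟩ := h
  obtain ⟨s', t', h⟩ := h'
  have h1 : (s' ++ [x']) ++ y :: t' = (s ++ [x]) ++ y :: t := by simpa using h
  have hl' : (s ++ [x] ++ y :: t).Nodup := by simpa using hl
  have hl'' := hl'
  rw [← h1] at hl''
  rw [List.append_eq_append_iff] at h1
  rcases h1 with ⟨a, ha, hb⟩ | ⟨a, ha, hb⟩
  · rcases a with _ | ⟨c, a⟩
    · simp at ha; exact ha.2
    · simp only [List.cons_append, List.cons.injEq] at hb
      rw [ha, ← hb.1] at hl'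
      simp [List.nodup_append] at hl'
  · rcases a with _ | ⟨c, a⟩
    · simp at ha; exact ha.2.symm
    · simp only [List.cons_append, List.cons.injEq] at hb
      rw [ha, ← hb.1] at hl''
      simp [List.nodup_append] at hl''

/-- In a list without repetitions, an element has at most one successor. -/
lemma pair_infix_right_unique {l : List V} (hl : l.Nodup) {x y y' : V} (h : [x, y] <:+: l)
    (h' : [x, y'] <:+: l) : y = y' :=
  pair_infix_left_unique (List.nodup_reverse.2 hl)
    (by simpa using List.reverse_infix.2 h) (by simpa using List.reverse_infix.2 h')

open Classical in
lemma card_successors_le [Fintype V] {l : List V} (hl : l.Nodup) (F : Finset V) :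
    (Finset.univ.filter fun y => ∃ x ∈ F, [x, y] <:+: l).card ≤ F.card := by
  have : ∀ y ∈ (Finset.univ.filter fun y => ∃ x ∈ F, [x, y] <:+: l), ∃ x ∈ F, [x, y] <:+: l := by
    simp
  choose! f hf using this
  refine Finset.card_le_card_of_injOn f (fun y hy => (hf y hy).1) ?_
  intro y hy y' hy' h
  have h1 := (hf y hy).2
  have h2 := (hf y' hy').2
  rw [← h] at h2
  exact pair_infix_right_unique hl h1 h2

open Classical in
lemma card_predecessors_le [Fintype V] {l : List V} (hl : l.Nodup) (F : Finset V) :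
    (Finset.univ.filter fun x => ∃ y ∈ F, [x, y] <:+: l).card ≤ F.card := by
  have := card_successors_le (List.nodup_reverse.2 hl) F
  refine le_trans (Finset.card_le_card ?_) this
  intro x
  simp only [Finset.mem_filter, Finset.mem_univ, true_and]
  rintro ⟨y, hy, h⟩
  exact ⟨y, hy, by simpa using List.reverse_infix.2 h⟩

open Classical in
/-- At most `3 |F|` middles of consecutive triples have a member of `F` in their triple. -/
lemma card_middles_le [Fintype V] {l : List V} (hl : l.Nodup) (F S : Finset V)
    (hS : ∀ y ∈ S, ∃ x z, Unbroken [x, y, z] l ∧ (x ∈ F ∨ y ∈ F ∨ z ∈ F)) :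
    S.card ≤ 3 * F.card := by
  have hsub : S ⊆ F ∪ ((Finset.univ.filter fun y => ∃ x ∈ F, [x, y] <:+: l) ∪
      (Finset.univ.filter fun x => ∃ y ∈ F, [x, y] <:+: l)) := by
    intro y hy
    simp only [Finset.mem_union, Finset.mem_filter, Finset.mem_univ, true_and]
    have key : ∀ a b : V, [a, y, b] <:+: l → [a, y] <:+: l ∧ [y, b] <:+: l := fun a b h =>
      ⟨List.IsInfix.trans ⟨[], [b], rfl⟩ h, List.IsInfix.trans ⟨[a], [], rfl⟩ h⟩
    obtain ⟨x, z, h, hF⟩ := hS y hy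
    rcases h with h | h
    · rcases hF with hF | hF | hF
      · exact Or.inr (Or.inl ⟨x, hF, (key _ _ h).1⟩)
      · exact Or.inl hF
      · exact Or.inr (Or.inr ⟨z, hF, (key _ _ h).2⟩)
    · have h : [z, y, x] <:+: l := by simpa using h
      rcases hF with hF | hF | hF
      · exact Or.inr (Or.inr ⟨x, hF, (key _ _ h).2⟩)
      · exact Or.inl hF
      · exact Or.inr (Or.inl ⟨z, hF, (key _ _ h).1⟩)
  have h1 := Finset.card_le_card hsub
  have h2 := Finset.card_union_le F ((Finset.univ.filter fun y => ∃ x ∈ F, [x, y] <:+: l) ∪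
      (Finset.univ.filter fun x => ∃ y ∈ F, [x, y] <:+: l))
  have h3 := Finset.card_union_le (Finset.univ.filter fun y => ∃ x ∈ F, [x, y] <:+: l)
      (Finset.univ.filter fun x => ∃ y ∈ F, [x, y] <:+: l)
  have h4 := card_successors_le hl F
  have h5 := card_predecessors_le hl F
  omega

end Lists

section Rotations

variable {V : Type*}

/-- `Rots G R l r l'`: the list `l'` arises from `l` by at most `r` Pósa rotations that fix the
last vertex and never produce a first vertex in `R`. -/
inductive Rots (G : SimpleGraph V) (R : Finset V) (l : List V) : ℕ → List V → Prop
  | refl : Rots G R l 0 l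
  | mono {r : ℕ} {l' : List V} : Rots G R l r l' → Rots G R l (r + 1) l'
  | step {r : ℕ} {p q : List V} {h x y : V} : Rots G R l r (p ++ x :: y :: q) →
      (p ++ [x]).head? = some h → G.Adj h y → x ∉ R →
      Rots G R l (r + 1) (x :: (p.reverse ++ y :: q))

lemma Rots.isPath {G : SimpleGraph V} {R : Finset V} {l l' : List V} {r : ℕ}
    (h : Rots G R l r l') (hc : l.IsChain G.Adj) :
    l'.Perm l ∧ l'.IsChain G.Adj ∧ l'.getLast? = l.getLast? := by
  induction h with
  | refl => exact ⟨List.Perm.refl _, hc, rfl⟩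
  | mono _ ih => exact ih
  | @step r p q h x y _ hh hadj _ ih =>
    obtain ⟨h1, h2, h3⟩ := ih
    refine ⟨?_, ?_, ?_⟩
    · refine List.Perm.trans ?_ h1
      refine List.Perm.trans ?_ List.perm_middle.symm
      exact (List.Perm.append_right _ (List.reverse_perm p)).cons x
    · have e : p ++ x :: y :: q = (p ++ [x]) ++ y :: q := by simp
      have e' : x :: (p.reverse ++ y :: q) = (p ++ [x]).reverse ++ y :: q := by simp
      rw [e, List.isChain_append] at h2
      rw [e', List.isChain_append]
      refine ⟨?_, h2.2.1, ?_⟩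
      · rw [List.isChain_reverse]
        exact h2.1.imp fun a b hab => hab.symm
      · intro a ha b hb
        rw [List.getLast?_reverse, hh] at ha
        simp at ha hb
        subst ha hb
        exact hadj
    · rw [← h3]
      have e : p ++ x :: y :: q = (p ++ [x]) ++ y :: q := by simp
      have e' : x :: (p.reverse ++ y :: q) = (p ++ [x]).reverse ++ y :: q := by simp
      rw [e, e', List.getLast?_append_cons, List.getLast?_append_cons]

/-- Every two disjoint sets of at least `m` vertices have an edge between them. -/
def SetsJoined (G : SimpleGraph V) (m : ℕ) : Prop :=
  ∀ A B : Finset V, Disjoint A B → m ≤ A.card → m ≤ B.card → ∃ a ∈ A, ∃ b ∈ B, G.Adj a b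

open Classical in
lemma SetsJoined.exists_adj {G : SimpleGraph V} {m : ℕ} (hG : SetsJoined G m) {A B : Finset V}
    (hA : m ≤ A.card) (hB : 2 * m ≤ B.card) : ∃ a ∈ A, ∃ b ∈ B, G.Adj a b := by
  obtain ⟨A', hA', hc⟩ := Finset.exists_subset_card_eq hA
  obtain ⟨a, ha, b, hb, hab⟩ := hG A' (B \ A') Finset.disjoint_sdiff hc.ge (by
    have := Finset.le_card_sdiff A' B
    omega)
  exact ⟨a, hA' ha, b, (Finset.mem_sdiff.1 hb).1, hab⟩

variable [Fintype V]

open Classical in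
/-- The vertices with a neighbour in `X`. -/
noncomputable def nbhd (G : SimpleGraph V) (X : Finset V) : Finset V :=
  Finset.univ.filter fun v => ∃ x ∈ X, G.Adj x v

lemma mem_nbhd {G : SimpleGraph V} {X : Finset V} {v : V} :
    v ∈ nbhd G X ↔ ∃ x ∈ X, G.Adj x v := by simp [nbhd]

open Classical in
/-- The middles of those triples in `T` that avoid `R`. -/
noncomputable def middles (T : V → V → V → Prop) (R : Finset V) : Finset V :=
  Finset.univ.filter fun y => ∃ x z, T x y z ∧ x ∉ R ∧ y ∉ R ∧ z ∉ R

lemma mem_middles {T : V → V → V → Prop} {R : Finset V} {y : V} :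
    y ∈ middles T R ↔ ∃ x z, T x y z ∧ x ∉ R ∧ y ∉ R ∧ z ∉ R := by simp [middles]

open Classical in
/-- Deleting a small set `R` leaves a set of vertices expanding into the middles that remain. -/
lemma SetsJoined.exists_expanding_core {G : SimpleGraph V} {m : ℕ} (hG : SetsJoined G m)
    {l : List V}
    (hl : l.Nodup) {T : V → V → V → Prop} (hT : ∀ x y z, T x y z → Unbroken [x, y, z] l)
    (hc : 21 * m ≤ (middles T ∅).card) :
    ∃ R : Finset V, 2 * m ≤ (middles T R).card ∧
      ∀ X : Finset V, Disjoint X R → X.card ≤ m → 6 * X.card ≤ (nbhd G X ∩ middles T R).card := by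
  let S : Finset (Finset V) := Finset.univ.filter fun R =>
    R.card ≤ 2 * m ∧ (nbhd G R ∩ middles T R).card ≤ 6 * R.card
  have hS : S.Nonempty := by
    refine ⟨∅, ?_⟩
    have : nbhd G (∅ : Finset V) = ∅ := by ext; simp [mem_nbhd]
    simp [S, this]
  obtain ⟨R, hRS, hmax⟩ := Finset.exists_max_image S Finset.card hS
  simp only [S, Finset.mem_filter, Finset.mem_univ, true_and] at hRS hmax
  have hmid : ∀ R : Finset V, (middles T ∅).card ≤ (middles T R).card + 3 * R.card := by
    intro R
    have h1 : (middles T ∅ \ middles T R).card ≤ 3 * R.card := by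
      refine card_middles_le hl R _ ?_
      intro y hy
      rw [Finset.mem_sdiff, mem_middles, mem_middles] at hy
      obtain ⟨⟨x, z, h, -⟩, h2⟩ := hy
      refine ⟨x, z, hT _ _ _ h, ?_⟩
      by_contra! hcon
      exact h2 ⟨x, z, h, hcon⟩
    have := Finset.le_card_sdiff (middles T R) (middles T ∅)
    omega
  have hRm : R.card < m := by
    by_contra! hm
    obtain ⟨a, ha, b, hb, hab⟩ := hG.exists_adj (B := middles T R \ nbhd G R) hm (by
      have h1 := hmid R
      have h2 := Finset.card_sdiff_add_card_inter (middles T R) (nbhd G R)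
      rw [Finset.inter_comm] at h2
      omega)
    rw [Finset.mem_sdiff, mem_nbhd] at hb
    exact hb.2 ⟨a, ha, hab⟩
  refine ⟨R, by have := hmid R; omega, ?_⟩
  intro X hXR hX
  by_contra! hlt
  have hcu := Finset.card_union_of_disjoint hXR
  have hsub : nbhd G (X ∪ R) ∩ middles T (X ∪ R) ⊆
      (nbhd G X ∩ middles T R) ∪ (nbhd G R ∩ middles T R) := by
    intro v hv
    simp only [Finset.mem_inter, Finset.mem_union, mem_nbhd, mem_middles] at hv ⊢
    obtain ⟨⟨x, hx, hxv⟩, a, b, h, h1, h2, h3⟩ := hv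
    push Not at h1 h2 h3
    have hm : ∃ x z, T x v z ∧ x ∉ R ∧ v ∉ R ∧ z ∉ R := ⟨a, b, h, h1.2, h2.2, h3.2⟩
    rcases hx with hx | hx
    · exact Or.inl ⟨⟨x, hx, hxv⟩, hm⟩
    · exact Or.inr ⟨⟨x, hx, hxv⟩, hm⟩
  have h1 := Finset.card_le_card hsub
  have h2 := Finset.card_union_le (nbhd G X ∩ middles T R) (nbhd G R ∩ middles T R)
  have h3 := hmax (X ∪ R) ⟨by omega, by omega⟩
  omega

open Classical in
/-- The first vertices outside `R` of the paths obtained by at most `r` rotations. -/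
noncomputable def rotEnds (G : SimpleGraph V) (R : Finset V) (l : List V) (r : ℕ) : Finset V :=
  Finset.univ.filter fun v => v ∉ R ∧ ∃ l', Rots G R l r l' ∧ l'.head? = some v

lemma mem_rotEnds {G : SimpleGraph V} {R : Finset V} {l : List V} {r : ℕ} {v : V} :
    v ∈ rotEnds G R l r ↔ v ∉ R ∧ ∃ l', Rots G R l r l' ∧ l'.head? = some v := by simp [rotEnds]

lemma rotEnds_mono {G : SimpleGraph V} {R : Finset V} {l : List V} {r : ℕ} :
    rotEnds G R l r ⊆ rotEnds G R l (r + 1) := by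
  intro v
  rw [mem_rotEnds, mem_rotEnds]
  rintro ⟨h, l', h1, h2⟩
  exact ⟨h, l', h1.mono, h2⟩

open Classical in
lemma Rots.exists_breaks {G : SimpleGraph V} {R : Finset V} {l l' : List V} {r : ℕ}
    (h : Rots G R l r l') :
    ∃ H ⊆ rotEnds G R l r, H.card ≤ r ∧
      ∀ I, Unbroken I l → (∀ v ∈ I, v ∉ H) → Unbroken I l' := by
  induction h with
  | refl => exact ⟨∅, by simp, by simp, fun I hI _ => hI⟩
  | mono _ ih =>
    obtain ⟨H, h1, h2, h3⟩ := ih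
    exact ⟨H, h1.trans rotEnds_mono, by omega, h3⟩
  | @step r p q h x y h0 hh hadj hx ih =>
    obtain ⟨H, h1, h2, h3⟩ := ih
    refine ⟨insert x H, ?_, ?_, ?_⟩
    · rw [Finset.insert_subset_iff]
      exact ⟨mem_rotEnds.2 ⟨hx, _, h0.step hh hadj hx, rfl⟩, h1.trans rotEnds_mono⟩
    · exact (Finset.card_insert_le _ _).trans (by omega)
    · intro I hI hd
      refine (h3 I hI fun v hv => fun hvH => hd v hv (Finset.mem_insert_of_mem hvH)).rotate ?_
      exact fun hxI => hd x hxI (Finset.mem_insert_self _ _)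

/-- Rotating at the middle of an intact triple makes one of its outer vertices a first vertex. -/
lemma Rots.step_triple {G : SimpleGraph V} {R : Finset V} {l l' : List V} {r : ℕ} {h x y z : V}
    (hr : Rots G R l r l') (hh : l'.head? = some h) (hadj : G.Adj h y)
    (hI : Unbroken [x, y, z] l') (hx : x ∉ R) (hz : z ∉ R) :
    x ∈ rotEnds G R l (r + 1) ∨ z ∈ rotEnds G R l (r + 1) := by
  have key : ∀ x z, [x, y, z] <:+: l' → x ∉ R → x ∈ rotEnds G R l (r + 1) := by
    rintro x z ⟨s, t, rfl⟩ hx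
    have e : s ++ [x, y, z] ++ t = s ++ x :: y :: (z :: t) := by simp
    have e' : s ++ [x, y, z] ++ t = (s ++ [x]) ++ y :: (z :: t) := by simp
    rw [e] at hr
    refine mem_rotEnds.2 ⟨hx, _, hr.step (h := h) ?_ hadj hx, rfl⟩
    rw [e'] at hh
    cases s <;> simpa using hh
  rcases hI with hI | hI
  · exact Or.inl (key x z hI hx)
  · exact Or.inr (key z x (by simpa using hI) hz)

open Classical in
lemma three_mul_card_rotEnds {G : SimpleGraph V} {R : Finset V} {l : List V} (hl : l.Nodup)
    {T : V → V → V → Prop} (hT : ∀ x y z, T x y z → Unbroken [x, y, z] l) (r : ℕ) (S : Finset V)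
    (hS : S ⊆ middles T R)
    (hadj : ∀ y ∈ S, ∃ l' h, Rots G R l r l' ∧ l'.head? = some h ∧ G.Adj h y) :
    S.card ≤ 3 * (rotEnds G R l (r + 1)).card := by
  refine card_middles_le hl _ _ ?_
  intro y hy
  obtain ⟨x, z, hxyz, hx, hy', hz⟩ := mem_middles.1 (hS hy)
  refine ⟨x, z, hT _ _ _ hxyz, ?_⟩
  by_contra! hcon
  obtain ⟨l', h, hr, hh, hadj⟩ := hadj y hy
  obtain ⟨H, h1, -, h3⟩ := hr.exists_breaks
  have h4 := h3 _ (hT _ _ _ hxyz) (by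
    have h1' := h1.trans rotEnds_mono
    intro v hv hvH
    have := h1' hvH
    simp only [List.mem_cons, List.not_mem_nil, or_false] at hv
    rcases hv with rfl | rfl | rfl <;> tauto)
  rcases hr.step_triple hh hadj h4 hx hz with h | h <;> tauto

open Classical in
/-- If sets of reachable first vertices expand into the middles, then few rotations reach many
first vertices. -/
lemma exists_rotated_ends {G : SimpleGraph V} {R : Finset V} {l : List V} (hl : l.Nodup)
    (hc : l.IsChain G.Adj) {T : V → V → V → Prop} (hT : ∀ x y z, T x y z → Unbroken [x, y, z] l)
    {a y : V} (ha : l.head? = some a) (hy : y ∈ middles T R) (hay : G.Adj a y) {s r : ℕ}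
    (hexp : ∀ X : Finset V, Disjoint X R →
      (∀ v ∈ X, ∃ l' : List V, l'.Perm l ∧ l'.IsChain G.Adj ∧ l'.head? = some v) →
      X.card ≤ s → 6 * X.card ≤ (nbhd G X ∩ middles T R).card) (hr : s ≤ 2 ^ r) :
    ∃ F : Finset V, s ≤ F.card ∧ ∀ v ∈ F, ∃ l' : List V, l'.Perm l ∧ l'.IsChain G.Adj ∧
      l'.head? = some v ∧ l'.getLast? = l.getLast? ∧ ∃ H : Finset V, H.card ≤ r + 1 ∧
        ∀ I, Unbroken I l → (∀ v ∈ I, v ∉ H) → Unbroken I l' := by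
  have hgrow : ∀ r, min s (2 ^ r) ≤ (rotEnds G R l (r + 1)).card := by
    intro r
    induction r with
    | zero =>
      have := three_mul_card_rotEnds (G := G) (R := R) hl hT 0 {y} (by simpa using hy) (by
        intro y' hy'
        rw [Finset.mem_singleton] at hy'
        subst hy'
        exact ⟨l, a, .refl, ha, hay⟩)
      simp only [Finset.card_singleton] at this
      have h2 := min_le_right s (2 ^ 0)
      simp only [pow_zero, zero_add] at h2 this ⊢
      omega
    | succ r ih =>
      rcases le_or_gt s (rotEnds G R l (r + 1)).card with h | h
      · exact (min_le_left _ _).trans (h.trans (Finset.card_le_card rotEnds_mono))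
      · have h1 := hexp (rotEnds G R l (r + 1))
          (Finset.disjoint_left.2 fun v hv => (mem_rotEnds.1 hv).1)
          (by
            intro v hv
            obtain ⟨-, l', h1, h2⟩ := mem_rotEnds.1 hv
            exact ⟨l', (h1.isPath hc).1, (h1.isPath hc).2.1, h2⟩) h.le
        have h2 := three_mul_card_rotEnds (G := G) (R := R) hl hT (r + 1)
          (nbhd G (rotEnds G R l (r + 1)) ∩ middles T R) Finset.inter_subset_right (by
            intro y' hy'
            obtain ⟨x, hx, hxy⟩ := mem_nbhd.1 (Finset.mem_inter.1 hy').1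
            obtain ⟨-, l', h1, h2⟩ := mem_rotEnds.1 hx
            exact ⟨l', x, h1, h2, hxy⟩)
        rw [pow_succ]
        omega
  refine ⟨rotEnds G R l (r + 1), by have := hgrow r; rwa [min_eq_left hr] at this, ?_⟩
  intro v hv
  obtain ⟨-, l', h1, h2⟩ := mem_rotEnds.1 hv
  obtain ⟨H, -, h3, h4⟩ := h1.exists_breaks
  obtain ⟨h5, h6, h7⟩ := h1.isPath hc
  exact ⟨l', h5, h6, h2, h7, H, h3, h4⟩

end Rotations

section Cycles

variable {V : Type*}

/-- A list without repetitions through all vertices whose ends are adjacent closes up to a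
Hamilton cycle. -/
lemma exists_isHamiltonianCycle_of_list [Fintype V] [DecidableEq V] {G : SimpleGraph V}
    {l : List V} (hl : l.Nodup) (hc : l.IsChain G.Adj) (hlen : 3 ≤ l.length) (hall : ∀ v, v ∈ l)
    {x y : V} (hx : l.head? = some x) (hy : l.getLast? = some y) (hxy : G.Adj x y) :
    ∃ (v : V) (c : G.Walk v v), c.IsHamiltonianCycle := by
  have hne : l ≠ [] := by rintro rfl; simp at hlen
  have hx' : l.head hne = x := by
    rw [List.head?_eq_some_head hne] at hx; simpa using hx
  have hy' : l.getLast hne = y := by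
    rw [List.getLast?_eq_some_getLast hne] at hy; simpa using hy
  let w : G.Walk (l.head hne) (l.getLast hne) := Walk.ofSupport l hne hc
  have hws : w.support = l := Walk.support_ofSupport hne hc
  have hwp : w.IsPath := by rw [Walk.isPath_def, hws]; exact hl
  have hadj : G.Adj (l.getLast hne) (l.head hne) := by rw [hx', hy']; exact hxy.symm
  have hwl : w.length + 1 = l.length := by
    have := w.length_support
    rw [hws] at this
    exact this.symm
  refine ⟨_, Walk.cons hadj w, ?_⟩
  rw [Walk.isHamiltonianCycle_iff_isCycle_and_length_eq]
  refine ⟨?_, ?_⟩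
  · rw [Walk.cons_isCycle_iff]
    refine ⟨hwp, fun hmem => ?_⟩
    have := hwp.length_eq_one_of_mem_edges (by rw [Sym2.eq_swap]; exact hmem)
    omega
  · rw [Walk.length_cons, hwl]
    rw [← List.toFinset_card_of_nodup hl, ← Finset.card_univ]
    congr 1
    ext v
    simp [hall]

lemma exists_longest_path [Fintype V] [Nonempty V] (G : SimpleGraph V) :
    ∃ l : List V, l.Nodup ∧ l.IsChain G.Adj ∧ l ≠ [] ∧
      ∀ l' : List V, l'.Nodup → l'.IsChain G.Adj → l'.length ≤ l.length := by
  classical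
  obtain ⟨v⟩ := ‹Nonempty V›
  let P : ℕ → Prop := fun k => ∃ l : List V, l.Nodup ∧ l.IsChain G.Adj ∧ l.length = k
  have h1 : P 1 := ⟨[v], by simp, by simp, rfl⟩
  have hV : 1 ≤ Fintype.card V := Fintype.card_pos_iff.2 ⟨v⟩
  obtain ⟨l, hl, hc, hk⟩ := Nat.findGreatest_spec hV h1
  have hk1 := Nat.le_findGreatest hV h1
  refine ⟨l, hl, hc, ?_, ?_⟩
  · rintro rfl
    simp only [List.length_nil] at hk
    omega
  · intro l' hl' hc'
    rw [hk]
    exact Nat.le_findGreatest hl'.length_le_card ⟨l', hl', hc', rfl⟩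

/-- If the ends of a path are adjacent and some vertex outside is adjacent to the path, then there
is a longer path. -/
lemma exists_longer_path {G : SimpleGraph V} {l : List V} (hl : l.Nodup) (hc : l.IsChain G.Adj)
    {x y : V} (hx : l.head? = some x) (hy : l.getLast? = some y) (hxy : G.Adj x y)
    {v w : V} (hv : v ∉ l) (hw : w ∈ l) (hvw : G.Adj v w) :
    ∃ l' : List V, l'.Nodup ∧ l'.IsChain G.Adj ∧ l'.length = l.length + 1 := by
  obtain ⟨s, t, rfl⟩ := List.append_of_mem hw
  have hp : ((w :: t) ++ s).Perm (s ++ w :: t) := List.perm_append_comm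
  refine ⟨v :: ((w :: t) ++ s), ?_, ?_, ?_⟩
  · rw [List.nodup_cons, hp.mem_iff, hp.nodup_iff]
    exact ⟨hv, hl⟩
  · rw [List.isChain_cons]
    refine ⟨by simpa using hvw, ?_⟩
    rw [List.isChain_append] at hc ⊢
    refine ⟨hc.2.1, hc.1, ?_⟩
    intro a ha b hb
    rw [List.getLast?_append_cons] at hy
    rw [hy] at ha
    rw [List.head?_append, Option.mem_def.1 hb] at hx
    simp at ha hx
    subst ha hx
    exact hxy.symm
  · simp
    omega

lemma exists_infix_triple {l : List V} {y : V} (hy : y ∈ l) (hh : l.head? ≠ some y)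
    (hg : l.getLast? ≠ some y) : ∃ x z, [x, y, z] <:+: l := by
  obtain ⟨s, t, rfl⟩ := List.append_of_mem hy
  rcases List.eq_nil_or_concat s with rfl | ⟨s, x, rfl⟩
  · simp at hh
  rcases t with _ | ⟨z, t⟩
  · simp at hg
  · exact ⟨x, z, s, t, by simp⟩

/-- A long list without repetitions contains many disjoint blocks of a given length. -/
lemma exists_segments {l : List V} (hl : l.Nodup) {L k : ℕ} (h : L * k ≤ l.length) :
    ∃ seg : Fin L → List V, (∀ j, seg j <:+: l) ∧ (∀ j, (seg j).length = k) ∧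
      ∀ i j v, v ∈ seg i → v ∈ seg j → i = j := by
  refine ⟨fun j => (l.drop (j * k)).take k, ?_, ?_, ?_⟩
  · intro j
    exact (List.take_prefix _ _).isInfix.trans (List.drop_suffix _ _).isInfix
  · intro j
    have : (j + 1 : ℕ) * k ≤ L * k := Nat.mul_le_mul_right _ j.2
    rw [add_mul] at this
    simp
    omega
  · have key : ∀ i j : Fin L, ∀ v, i < j → v ∈ (l.drop (i * k)).take k →
        v ∈ (l.drop (j * k)).take k → False := by
      intro i j v hij h1 h2
      have : (i + 1 : ℕ) * k ≤ j * k := Nat.mul_le_mul_right _ hij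
      rw [List.take_drop] at h1
      exact List.disjoint_take_drop hl (by rw [add_mul] at this; omega)
        (List.mem_of_mem_drop h1) (List.mem_of_mem_take h2)
    intro i j v h1 h2
    rcases lt_trichotomy i j with h | h | h
    · exact (key i j v h h1 h2).elim
    · exact h
    · exact (key j i v h h2 h1).elim

open Classical in
/-- A list containing `2k` disjoint blocks splits into two lists that contain `k` of them each. -/
lemma exists_balanced_split {ι : Type*} [Fintype ι] {seg : ι → List V} {Q : List V} {k : ℕ}
    (hne : ∀ j, seg j ≠ []) (hk : 0 < k) (hdisj : ∀ i j v, v ∈ seg i → v ∈ seg j → i = j)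
    (hU : 2 * k ≤ (Finset.univ.filter fun j => Unbroken (seg j) Q).card) :
    ∃ Q₁ Q₂, Q = Q₁ ++ Q₂ ∧ k ≤ (Finset.univ.filter fun j => Unbroken (seg j) Q₁).card ∧
      k ≤ (Finset.univ.filter fun j => Unbroken (seg j) Q₂).card := by
  let f : ℕ → Finset ι := fun i => Finset.univ.filter fun j => Unbroken (seg j) (Q.take i)
  have hex : ∃ i, k ≤ (f i).card := ⟨Q.length, by simp only [f, List.take_length]; omega⟩
  obtain ⟨i, hi, hmin⟩ : ∃ i, k ≤ (f (i + 1)).card ∧ (f i).card < k := by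
    have h1 := Nat.find_spec hex
    have h0 : Nat.find hex ≠ 0 := by
      intro h0
      rw [h0] at h1
      have : f 0 = ∅ := by
        ext j
        simp [f, Unbroken, hne j]
      rw [this] at h1
      simp at h1
      omega
    obtain ⟨i, hi⟩ := Nat.exists_eq_succ_of_ne_zero h0
    refine ⟨i, by rw [hi] at h1; exact h1, ?_⟩
    have := Nat.find_min hex (m := i) (by omega)
    omega
  have hlt : i < Q.length := by
    by_contra! h
    have : f i = f (i + 1) := by
      simp only [f, List.take_of_length_le h, List.take_of_length_le (h.trans (Nat.le_succ i))]
    rw [this] at hmin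
    omega
  refine ⟨Q.take (i + 1), Q.drop (i + 1), (List.take_append_drop _ _).symm, hi, ?_⟩
  have hQ : Q = Q.take i ++ Q[i] :: Q.drop (i + 1) := by simp
  have hsub : (Finset.univ.filter fun j => Unbroken (seg j) Q) ⊆ f i ∪
      ((Finset.univ.filter fun j => Q[i] ∈ seg j) ∪
        (Finset.univ.filter fun j => Unbroken (seg j) (Q.drop (i + 1)))) := by
    intro j hj
    simp only [f, Finset.mem_filter, Finset.mem_univ, true_and, Finset.mem_union] at hj ⊢
    by_cases hm : Q[i] ∈ seg j
    · exact Or.inr (Or.inl hm)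
    · rw [hQ] at hj
      rcases hj.of_append_cons hm with h | h
      · exact Or.inl h
      · exact Or.inr (Or.inr h)
  have h1 : (Finset.univ.filter fun j => Q[i] ∈ seg j).card ≤ 1 := by
    rw [Finset.card_le_one]
    intro a ha b hb
    simp only [Finset.mem_filter, Finset.mem_univ, true_and] at ha hb
    exact hdisj _ _ _ ha hb
  have h2 := Finset.card_le_card hsub
  have h3 := Finset.card_union_le (f i) ((Finset.univ.filter fun j => Q[i] ∈ seg j) ∪
        (Finset.univ.filter fun j => Unbroken (seg j) (Q.drop (i + 1))))
  have h4 := Finset.card_union_le (Finset.univ.filter fun j => Q[i] ∈ seg j)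
        (Finset.univ.filter fun j => Unbroken (seg j) (Q.drop (i + 1)))
  omega

open Classical in
/-- Deleting a set `H` destroys at most `|H|` of a family of disjoint blocks. -/
lemma card_avoiding_segments {L : ℕ} {seg : Fin L → List V}
    (hdisj : ∀ i j v, v ∈ seg i → v ∈ seg j → i = j) (H : Finset V) :
    L ≤ (Finset.univ.filter fun j => ∀ v ∈ seg j, v ∉ H).card + H.card := by
  have h1 : (Finset.univ.filter fun j => ¬ ∀ v ∈ seg j, v ∉ H).card ≤ H.card := by
    have : ∀ j ∈ (Finset.univ.filter fun j => ¬ ∀ v ∈ seg j, v ∉ H),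
        ∃ v : V, v ∈ H ∧ v ∈ seg j := by
      intro j hj
      simp only [Finset.mem_filter, Finset.mem_univ, true_and] at hj
      push Not at hj
      obtain ⟨v, h1, h2⟩ := hj
      exact ⟨v, h2, h1⟩
    rcases isEmpty_or_nonempty V with hV | hV
    · rw [Finset.filter_false_of_mem fun j _ => by simp]
      simp
    choose! g hg using this
    refine Finset.card_le_card_of_injOn g (fun j hj => (hg j hj).1) ?_
    intro i hi j hj h
    exact hdisj i j (g i) (hg i hi).2 (h ▸ (hg j hj).2)
  have h2 := Finset.card_filter_add_card_filter_not (s := (Finset.univ : Finset (Fin L)))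
    (fun j => ∀ v ∈ seg j, v ∉ H)
  rw [Finset.card_univ, Fintype.card_fin] at h2
  omega

end Cycles

section Expanders

variable {V : Type*}

lemma mem_of_adj_of_head_eq {G : SimpleGraph V} {l l' : List V} (hl : l.Nodup)
    (hmax : ∀ l' : List V, l'.Nodup → l'.IsChain G.Adj → l'.length ≤ l.length)
    (hp : l'.Perm l) (hc : l'.IsChain G.Adj) {x v : V} (hx : l'.head? = some x)
    (hxv : G.Adj x v) : v ∈ l := by
  by_contra hv
  have h1 := hmax (v :: l') (by
    rw [List.nodup_cons, hp.mem_iff, hp.nodup_iff]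
    exact ⟨hv, hl⟩) (by
    rw [List.isChain_cons]
    refine ⟨?_, hc⟩
    intro y hy
    rw [hx] at hy
    simp at hy
    subst hy
    exact hxv.symm)
  rw [List.length_cons, hp.length_eq] at h1
  omega

lemma choose_le_eight_pow_mul_choose {L k t : ℕ} (h : L ≤ 8 * (k + 1 - t)) :
    L.choose t ≤ 8 ^ t * k.choose t := by
  have h1 : L.descFactorial t ≤ 8 ^ t * k.descFactorial t :=
    calc L.descFactorial t ≤ L ^ t := Nat.descFactorial_le_pow _ _
      _ ≤ (8 * (k + 1 - t)) ^ t := Nat.pow_le_pow_left h _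
      _ = 8 ^ t * (k + 1 - t) ^ t := mul_pow _ _ _
      _ ≤ _ := Nat.mul_le_mul_left _ (Nat.pow_sub_le_descFactorial _ _)
  rw [Nat.descFactorial_eq_factorial_mul_choose, Nat.descFactorial_eq_factorial_mul_choose] at h1
  refine Nat.le_of_mul_le_mul_left ?_ (Nat.factorial_pos t)
  calc _ ≤ _ := h1
    _ = _ := by ring

open Classical in
/-- Some pair of block families serves more than `2mn` of the pairs of ends. -/
lemma exists_popular_families {L k t m s n : ℕ} {P : Finset (V × V)}
    {Fit : V × V → Finset (Fin L) × Finset (Fin L) → Prop}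
    (hP : s * s ≤ P.card) (ht : t ≤ k) (hL : L ≤ 8 * (k + 1 - t))
    (hcount : 2 * m * n * 64 ^ t < s * s)
    (hfit : ∀ e ∈ P, ∃ U₁ U₂ : Finset (Fin L), k ≤ U₁.card ∧ k ≤ U₂.card ∧
      ∀ J₁ ⊆ U₁, ∀ J₂ ⊆ U₂, Fit e (J₁, J₂)) :
    ∃ J₁ J₂ : Finset (Fin L), J₁.card = t ∧ J₂.card = t ∧
      2 * m * n < (P.filter fun e => Fit e (J₁, J₂)).card := by
  by_contra! hcon
  let 𝒥 : Finset (Finset (Fin L)) := Finset.powersetCard t Finset.univ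
  have h1 := Finset.card_mul_le_card_mul (s := P) (t := 𝒥 ×ˢ 𝒥) Fit
    (m := k.choose t * k.choose t) (n := 2 * m * n) (by
      intro e he
      obtain ⟨U₁, U₂, hU₁, hU₂, hU⟩ := hfit e he
      calc k.choose t * k.choose t ≤ U₁.card.choose t * U₂.card.choose t :=
            Nat.mul_le_mul (Nat.choose_le_choose _ hU₁) (Nat.choose_le_choose _ hU₂)
        _ = (Finset.powersetCard t U₁ ×ˢ Finset.powersetCard t U₂).card := by
            rw [Finset.card_product, Finset.card_powersetCard, Finset.card_powersetCard]
        _ ≤ _ := by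
            refine Finset.card_le_card ?_
            rintro ⟨J₁, J₂⟩ hJ
            rw [Finset.mem_product, Finset.mem_powersetCard, Finset.mem_powersetCard] at hJ
            rw [Finset.mem_bipartiteAbove, Finset.mem_product, Finset.mem_powersetCard,
              Finset.mem_powersetCard]
            exact ⟨⟨⟨Finset.subset_univ _, hJ.1.2⟩, Finset.subset_univ _, hJ.2.2⟩,
              hU _ hJ.1.1 _ hJ.2.1⟩) (by
      rintro ⟨J₁, J₂⟩ hJ
      rw [Finset.mem_product, Finset.mem_powersetCard, Finset.mem_powersetCard] at hJ
      exact hcon J₁ J₂ hJ.1.2 hJ.2.2)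
  rw [Finset.card_product, Finset.card_powersetCard, Finset.card_univ, Fintype.card_fin] at h1
  have h2 := choose_le_eight_pow_mul_choose hL
  have hpos : 0 < k.choose t * k.choose t :=
    Nat.mul_pos (Nat.choose_pos ht) (Nat.choose_pos ht)
  have h3 : s * s * (k.choose t * k.choose t) ≤
      2 * m * n * 64 ^ t * (k.choose t * k.choose t) :=
    calc _ ≤ P.card * (k.choose t * k.choose t) := Nat.mul_le_mul_right _ hP
      _ ≤ _ := h1
      _ ≤ (8 ^ t * k.choose t) * (8 ^ t * k.choose t) * (2 * m * n) :=
          Nat.mul_le_mul_right _ (Nat.mul_le_mul h2 h2)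
      _ = 2 * m * n * (8 ^ t * 8 ^ t) * (k.choose t * k.choose t) := by ring
      _ = _ := by rw [← mul_pow]; norm_num
  exact absurd (Nat.le_of_mul_le_mul_right h3 hpos) (not_le.2 hcount)

variable [Fintype V]

open Classical in
lemma length_le_card_middles_add_two {l : List V} (hl : l.Nodup) :
    l.length ≤ (middles (fun x y z => [x, y, z] <:+: l) ∅).card + 2 := by
  rcases l.eq_nil_or_concat with rfl | ⟨l', b, rfl⟩
  · simp
  rw [List.concat_eq_append] at hl ⊢
  have hne : l' ++ [b] ≠ [] := by simp
  have hsub : (l' ++ [b]).toFinset ⊆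
      middles (fun x y z => [x, y, z] <:+: l' ++ [b]) ∅ ∪ {(l' ++ [b]).head hne, b} := by
    intro v hv
    by_contra hcon
    simp only [Finset.mem_union, Finset.mem_insert, Finset.mem_singleton, not_or] at hcon
    obtain ⟨x, z, h⟩ := exists_infix_triple (List.mem_toFinset.1 hv)
      (by rw [List.head?_eq_some_head hne]; simpa using fun h => hcon.2.1 h.symm)
      (by simpa using fun h => hcon.2.2 h.symm)
    exact hcon.1 (mem_middles.2 ⟨x, z, h, by simp⟩)
  have h1 := Finset.card_le_card hsub
  rw [List.toFinset_card_of_nodup hl] at h1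
  have h2 := Finset.card_union_le
    (middles (fun x y z => [x, y, z] <:+: l' ++ [b]) ∅) {(l' ++ [b]).head hne, b}
  have h3 := Finset.card_le_two (a := (l' ++ [b]).head hne) (b := b)
  omega

open Classical in
lemma card_middles_segments {l : List V} (hl : l.Nodup) {L k : ℕ} {seg : Fin L → List V}
    (hinf : ∀ j, seg j <:+: l) (hlen : ∀ j, (seg j).length = k)
    (hdisj : ∀ i j v, v ∈ seg i → v ∈ seg j → i = j) (J : Finset (Fin L)) :
    J.card * (k - 2) ≤ (middles (fun x y z => ∃ j ∈ J, [x, y, z] <:+: seg j) ∅).card := by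
  have hmem : ∀ j v, v ∈ middles (fun x y z => [x, y, z] <:+: seg j) ∅ → v ∈ seg j := by
    intro j v hv
    obtain ⟨x, z, h, -⟩ := mem_middles.1 hv
    exact h.subset (by simp)
  have h1 : (J.biUnion fun j => middles (fun x y z => [x, y, z] <:+: seg j) ∅) ⊆
      middles (fun x y z => ∃ j ∈ J, [x, y, z] <:+: seg j) ∅ := by
    intro v hv
    obtain ⟨j, hj, hv⟩ := Finset.mem_biUnion.1 hv
    obtain ⟨x, z, h, -⟩ := mem_middles.1 hv
    exact mem_middles.2 ⟨x, z, ⟨j, hj, h⟩, by simp⟩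
  refine le_trans ?_ (Finset.card_le_card h1)
  rw [Finset.card_biUnion]
  · rw [← smul_eq_mul]
    refine Finset.card_nsmul_le_sum _ _ _ fun j _ => ?_
    have := length_le_card_middles_add_two ((hl.sublist (hinf j).sublist))
    rw [hlen] at this
    omega
  · intro i _ j _ hij
    refine Finset.disjoint_left.2 ?_
    intro v hv hv'
    exact hij (hdisj i j v (hmem i v hv) (hmem j v hv'))

open Classical in
/-- The first vertices of longest paths on a given vertex set expand into the interior. -/
lemma ends_of_longest_expand {G : SimpleGraph V} {l : List V} (hl : l.Nodup)
    (hmax : ∀ l' : List V, l'.Nodup → l'.IsChain G.Adj → l'.length ≤ l.length) {s : ℕ}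
    (hE : ∀ X : Finset V, X.card ≤ s → 9 * X.card ≤ (nbhd G X).card) (X : Finset V)
    (hX : ∀ v ∈ X, ∃ l' : List V, l'.Perm l ∧ l'.IsChain G.Adj ∧ l'.head? = some v)
    (hXs : X.card ≤ s) :
    6 * X.card ≤ (nbhd G X ∩ middles (fun x y z => [x, y, z] <:+: l) ∅).card := by
  rcases X.eq_empty_or_nonempty with rfl | hXne
  · simp
  have hpos := hXne.card_pos
  have hsub : middles (fun x y z => [x, y, z] <:+: l) ∅ ⊆ l.toFinset := by
    intro v hv
    obtain ⟨x, z, h, -⟩ := mem_middles.1 hv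
    exact List.mem_toFinset.2 (h.subset (by simp))
  have hN : nbhd G X ⊆ l.toFinset := by
    intro v hv
    obtain ⟨x, hx, hxv⟩ := mem_nbhd.1 hv
    obtain ⟨l', hp, hc, hh⟩ := hX x hx
    exact List.mem_toFinset.2 (mem_of_adj_of_head_eq hl hmax hp hc hh hxv)
  have h1 := length_le_card_middles_add_two hl
  have h2 := Finset.card_le_card (Finset.union_subset hN hsub)
  rw [List.toFinset_card_of_nodup hl] at h2
  have h3 := Finset.card_union_add_card_inter (nbhd G X)
    (middles (fun x y z => [x, y, z] <:+: l) ∅)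
  have h4 := hE X hXs
  omega

/-- A longest path in an expander has many possible first vertices after few rotations. -/
lemma exists_ends_of_longest {G : SimpleGraph V} {l : List V} (hl : l.Nodup)
    (hc : l.IsChain G.Adj) (hne : l ≠ [])
    (hmax : ∀ l' : List V, l'.Nodup → l'.IsChain G.Adj → l'.length ≤ l.length) {s r : ℕ}
    (hs : 0 < s) (hE : ∀ X : Finset V, X.card ≤ s → 9 * X.card ≤ (nbhd G X).card)
    (hr : s ≤ 2 ^ r) :
    ∃ F : Finset V, s ≤ F.card ∧ ∀ v ∈ F, ∃ l' : List V, l'.Perm l ∧ l'.IsChain G.Adj ∧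
      l'.head? = some v ∧ l'.getLast? = l.getLast? ∧ ∃ H : Finset V, H.card ≤ r + 1 ∧
        ∀ I, Unbroken I l → (∀ v ∈ I, v ∉ H) → Unbroken I l' := by
  classical
  have hh := List.head?_eq_some_head hne
  have h1 := ends_of_longest_expand hl hmax hE {l.head hne} (by
    intro v hv
    rw [Finset.mem_singleton] at hv
    subst hv
    exact ⟨l, .refl _, hc, hh⟩) (by rw [Finset.card_singleton]; exact hs)
  obtain ⟨y, hy⟩ := Finset.card_pos.1 (lt_of_lt_of_le (by simp) h1)
  rw [Finset.mem_inter, mem_nbhd] at hy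
  obtain ⟨⟨a, ha, hay⟩, hy⟩ := hy
  rw [Finset.mem_singleton] at ha
  subst ha
  exact exists_rotated_ends hl hc (T := fun x y z => [x, y, z] <:+: l)
    (fun x y z h => Or.inl h) hh hy hay
    (fun X _ h => ends_of_longest_expand hl hmax hE X h) hr

open Classical in
/-- A longest path in an expander can be rerouted, destroying few blocks, to join many pairs. -/
lemma exists_many_pairs {G : SimpleGraph V} {l : List V} (hl : l.Nodup)
    (hc : l.IsChain G.Adj) (hne : l ≠ [])
    (hmax : ∀ l' : List V, l'.Nodup → l'.IsChain G.Adj → l'.length ≤ l.length) {s r : ℕ}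
    (hs : 0 < s) (hE : ∀ X : Finset V, X.card ≤ s → 9 * X.card ≤ (nbhd G X).card)
    (hr : s ≤ 2 ^ r) :
    ∃ P : Finset (V × V), s * s ≤ P.card ∧ ∀ e ∈ P, ∃ l' : List V, l'.Perm l ∧
      l'.IsChain G.Adj ∧ l'.head? = some e.1 ∧ l'.getLast? = some e.2 ∧
      ∃ H : Finset V, H.card ≤ 2 * (r + 1) ∧
        ∀ I, Unbroken I l → (∀ v ∈ I, v ∉ H) → Unbroken I l' := by
  obtain ⟨F, hF, hFl⟩ := exists_ends_of_longest hl hc hne hmax hs hE hr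
  have hB : ∀ a ∈ F, ∃ B : Finset V, s ≤ B.card ∧ ∀ b ∈ B, ∃ l' : List V, l'.Perm l ∧
      l'.IsChain G.Adj ∧ l'.head? = some a ∧ l'.getLast? = some b ∧
      ∃ H : Finset V, H.card ≤ 2 * (r + 1) ∧
        ∀ I, Unbroken I l → (∀ v ∈ I, v ∉ H) → Unbroken I l' := by
    intro a ha
    obtain ⟨la, hp, hca, hh, -, H, hH, hI⟩ := hFl a ha
    have hrc : la.reverse.IsChain G.Adj := by
      rw [List.isChain_reverse]
      exact hca.imp fun a b hab => hab.symm
    have hrp : la.reverse.Perm l := (List.reverse_perm la).trans hp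
    obtain ⟨B, hBs, hBl⟩ := exists_ends_of_longest (l := la.reverse) (hrp.nodup_iff.2 hl) hrc
      (by rintro h; rw [h] at hrp; exact hne hrp.nil_eq.symm)
      (by rw [hrp.length_eq]; exact hmax) hs hE hr
    refine ⟨B, hBs, ?_⟩
    intro b hb
    obtain ⟨lb, hpb, hcb, hhb, hlb, H', hH', hI'⟩ := hBl b hb
    refine ⟨lb.reverse, ((List.reverse_perm lb).trans hpb).trans hrp, ?_, ?_, ?_, H ∪ H', ?_, ?_⟩
    · rw [List.isChain_reverse]
      exact hcb.imp fun a b hab => hab.symm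
    · rw [List.head?_reverse, hlb, List.getLast?_reverse, hh]
    · rw [List.getLast?_reverse, hhb]
    · have := Finset.card_union_le H H'
      omega
    · intro I h1 h2
      rw [unbroken_reverse_right]
      refine hI' I (unbroken_reverse_right.2 (hI I h1 ?_)) ?_
      · exact fun v hv hvH => h2 v hv (Finset.mem_union_left _ hvH)
      · exact fun v hv hvH => h2 v hv (Finset.mem_union_right _ hvH)
  choose! B hB1 hB2 using hB
  refine ⟨F.biUnion fun a => {a} ×ˢ B a, ?_, ?_⟩
  · rw [Finset.card_biUnion]
    · calc s * s ≤ F.card * s := Nat.mul_le_mul_right _ hF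
        _ = F.card • s := by simp
        _ ≤ _ := Finset.card_nsmul_le_sum _ _ _ fun a ha => by simpa using hB1 a ha
    · intro a _ a' _ haa'
      refine Finset.disjoint_left.2 ?_
      rintro ⟨u, v⟩ h1 h2
      simp only [Finset.mem_product, Finset.mem_singleton] at h1 h2
      exact haa' (h1.1.symm.trans h2.1)
  · rintro ⟨a, b⟩ hab
    simp only [Finset.mem_biUnion, Finset.mem_product, Finset.mem_singleton] at hab
    obtain ⟨a', ha', rfl, hb⟩ := hab
    exact hB2 _ ha' _ hb

/-- Rotating both halves of a path separately closes it to a cycle. -/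
lemma exists_closed_of_halves {G : SimpleGraph V} {m : ℕ} (hG : SetsJoined G m) {Q₁ Q₂ : List V}
    (hl : (Q₁ ++ Q₂).Nodup) (hc : (Q₁ ++ Q₂).IsChain G.Adj) {T₁ T₂ : V → V → V → Prop}
    {R₁ R₂ : Finset V} (hT₁ : ∀ x y z, T₁ x y z → Unbroken [x, y, z] Q₁)
    (hT₂ : ∀ x y z, T₂ x y z → Unbroken [x, y, z] Q₂)
    [DecidableEq V]
    (hR₁ : ∀ X : Finset V, Disjoint X R₁ → X.card ≤ m →
      6 * X.card ≤ (nbhd G X ∩ middles T₁ R₁).card)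
    (hR₂ : ∀ X : Finset V, Disjoint X R₂ → X.card ≤ m →
      6 * X.card ≤ (nbhd G X ∩ middles T₂ R₂).card)
    {a b y₁ y₂ : V} (ha : Q₁.head? = some a) (hb : Q₂.getLast? = some b)
    (hy₁ : y₁ ∈ middles T₁ R₁) (hay₁ : G.Adj a y₁) (hy₂ : y₂ ∈ middles T₂ R₂)
    (hby₂ : G.Adj b y₂) :
    ∃ c : List V, c.Perm (Q₁ ++ Q₂) ∧ c.IsChain G.Adj ∧ ∃ x y, c.head? = some x ∧
      c.getLast? = some y ∧ G.Adj x y := by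
  rw [List.nodup_append] at hl
  rw [List.isChain_append] at hc
  obtain ⟨F₁, hF₁, hF₁l⟩ := exists_rotated_ends hl.1 hc.1 hT₁ ha hy₁ hay₁
    (s := m) (r := m) (fun X h _ hX => by convert hR₁ X h hX) Nat.lt_two_pow_self.le
  obtain ⟨F₂, hF₂, hF₂l⟩ := exists_rotated_ends (l := Q₂.reverse) (List.nodup_reverse.2 hl.2.1)
    (by rw [List.isChain_reverse]; exact hc.2.1.imp fun a b hab => hab.symm)
    (fun x y z h => unbroken_reverse_right.2 (hT₂ x y z h))
    (by rw [List.head?_reverse]; exact hb) hy₂ hby₂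
    (s := m) (r := m) (fun X h _ hX => by convert hR₂ X h hX) Nat.lt_two_pow_self.le
  have hdisj : Disjoint F₁ F₂ := by
    rw [Finset.disjoint_left]
    intro v h1 h2
    obtain ⟨l₁, hp₁, -, hh₁, -⟩ := hF₁l v h1
    obtain ⟨l₂, hp₂, -, hh₂, -⟩ := hF₂l v h2
    have m1 : v ∈ Q₁ := hp₁.mem_iff.1 (List.mem_of_mem_head? hh₁)
    have m2 : v ∈ Q₂ := List.mem_reverse.1 (hp₂.mem_iff.1 (List.mem_of_mem_head? hh₂))
    exact hl.2.2 v m1 v m2 rfl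
  obtain ⟨x, hx, y, hy, hxy⟩ := hG F₁ F₂ hdisj hF₁ hF₂
  obtain ⟨l₁, hp₁, hc₁, hh₁, hg₁, -⟩ := hF₁l x hx
  obtain ⟨l₂, hp₂, hc₂, hh₂, hg₂, -⟩ := hF₂l y hy
  refine ⟨l₁ ++ l₂.reverse, hp₁.append ((List.reverse_perm l₂).trans
    (hp₂.trans (List.reverse_perm Q₂))), ?_, x, y, ?_, ?_, hxy⟩
  · rw [List.isChain_append]
    refine ⟨hc₁, ?_, ?_⟩
    · rw [List.isChain_reverse]
      exact hc₂.imp fun a b hab => hab.symm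
    · rw [hg₁, List.head?_reverse, hg₂, List.getLast?_reverse]
      exact hc.2.2
  · rw [List.head?_append, hh₁]
    rfl
  · rw [List.getLast?_append, List.getLast?_reverse, hh₂]
    rfl

open Classical in
/-- In an expander, the vertex set of a longest path spans a cycle. -/
lemma exists_closed_of_longest {G : SimpleGraph V} {m s r L d k t : ℕ} (hG : SetsJoined G m)
    (hE : ∀ X : Finset V, X.card ≤ s → 9 * X.card ≤ (nbhd G X).card) (hs : 0 < s)
    (hr : s ≤ 2 ^ r) (hk : 0 < k) (hd : 0 < d) (hLk : 2 * k + 2 * (r + 1) ≤ L) (ht : t ≤ k)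
    (hL : L ≤ 8 * (k + 1 - t)) (htd : 21 * m ≤ t * (d - 2))
    (hcount : 2 * m * Fintype.card V * 64 ^ t < s * s) {l : List V} (hl : l.Nodup)
    (hc : l.IsChain G.Adj) (hne : l ≠ [])
    (hmax : ∀ l' : List V, l'.Nodup → l'.IsChain G.Adj → l'.length ≤ l.length)
    (hLd : L * d ≤ l.length) :
    ∃ c : List V, c.Perm l ∧ c.IsChain G.Adj ∧ ∃ x y, c.head? = some x ∧
      c.getLast? = some y ∧ G.Adj x y := by
  obtain ⟨seg, hinf, hlen, hdisj⟩ := exists_segments hl hLd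
  have hsne : ∀ j, seg j ≠ [] := by
    intro j hj
    have := hlen j
    rw [hj] at this
    simp at this
    omega
  obtain ⟨P, hP, hPl⟩ := exists_many_pairs hl hc hne hmax hs hE hr
  let Fit : V × V → Finset (Fin L) × Finset (Fin L) → Prop := fun e J =>
    ∃ Q₁ Q₂ : List V, (Q₁ ++ Q₂).Perm l ∧ (Q₁ ++ Q₂).IsChain G.Adj ∧ Q₁.head? = some e.1 ∧
      Q₂.getLast? = some e.2 ∧ (∀ j ∈ J.1, Unbroken (seg j) Q₁) ∧ ∀ j ∈ J.2, Unbroken (seg j) Q₂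
  obtain ⟨J₁, J₂, hJ₁, hJ₂, hJ⟩ := exists_popular_families (Fit := Fit) hP ht hL hcount (by
    intro e he
    obtain ⟨Q, hp, hcQ, hh, hg, H, hH, hI⟩ := hPl e he
    obtain ⟨Q₁, Q₂, rfl, h1, h2⟩ := exists_balanced_split (Q := Q) hsne hk hdisj (by
      have h1 : L ≤ (Finset.univ.filter fun j => ∀ v ∈ seg j, v ∉ H).card + H.card := by
        convert card_avoiding_segments hdisj H
      have h2 : (Finset.univ.filter fun j => ∀ v ∈ seg j, v ∉ H) ⊆
          (Finset.univ.filter fun j => Unbroken (seg j) Q) := by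
        intro j hj
        simp only [Finset.mem_filter, Finset.mem_univ, true_and] at hj ⊢
        exact hI _ (Or.inl (hinf j)) hj
      have h3 := Finset.card_le_card h2
      omega)
    refine ⟨_, _, h1, h2, ?_⟩
    intro J₁ hJ₁ J₂ hJ₂
    refine ⟨Q₁, Q₂, hp, hcQ, ?_, ?_, fun j hj => by simpa using hJ₁ hj,
      fun j hj => by simpa using hJ₂ hj⟩
    · have hQ₁ : Q₁ ≠ [] := by
        rintro rfl
        obtain ⟨j, hj⟩ := Finset.card_pos.1 (hk.trans_le h1)
        simp [Unbroken, hsne j] at hj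
      rw [List.head?_append_of_ne_nil _ hQ₁] at hh
      exact hh
    · have hQ₂ : Q₂ ≠ [] := by
        rintro rfl
        obtain ⟨j, hj⟩ := Finset.card_pos.1 (hk.trans_le h2)
        simp [Unbroken, hsne j] at hj
      rw [List.getLast?_append_of_ne_nil _ hQ₂] at hg
      exact hg)
  have hcore : ∀ J : Finset (Fin L), J.card = t → ∃ R : Finset V,
      2 * m ≤ (middles (fun x y z => ∃ j ∈ J, [x, y, z] <:+: seg j) R).card ∧
      ∀ X : Finset V, Disjoint X R → X.card ≤ m → 6 * X.card ≤
        (nbhd G X ∩ middles (fun x y z => ∃ j ∈ J, [x, y, z] <:+: seg j) R).card := by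
    intro J hJ
    refine hG.exists_expanding_core hl ?_ ?_
    · rintro x y z ⟨j, -, h⟩
      exact Or.inl (h.trans (hinf j))
    · have := card_middles_segments hl hinf hlen hdisj J
      rw [hJ] at this
      exact htd.trans this
  obtain ⟨R₁, hR₁, hX₁⟩ := hcore J₁ hJ₁
  obtain ⟨R₂, hR₂, hX₂⟩ := hcore J₂ hJ₂
  have hbad : ∀ Y : Finset V, 2 * m ≤ Y.card →
      (Finset.univ.filter fun a => ∀ y ∈ Y, ¬ G.Adj a y).card ≤ m := by
    intro Y hY
    by_contra! hlt
    obtain ⟨a, ha, y, hy, hay⟩ := hG.exists_adj hlt.le hY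
    exact (Finset.mem_filter.1 ha).2 y hy hay
  have hb₁ := hbad _ hR₁
  have hb₂ := hbad _ hR₂
  set B₁ := Finset.univ.filter fun a =>
    ∀ y ∈ middles (fun x y z => ∃ j ∈ J₁, [x, y, z] <:+: seg j) R₁,
    ¬ G.Adj a y with hB₁
  set B₂ := Finset.univ.filter fun a =>
    ∀ y ∈ middles (fun x y z => ∃ j ∈ J₂, [x, y, z] <:+: seg j) R₂,
    ¬ G.Adj a y with hB₂
  obtain ⟨⟨a, b⟩, hab, hnot⟩ : ∃ e ∈ P.filter fun e => Fit e (J₁, J₂),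
      e ∉ (B₁ ×ˢ Finset.univ) ∪ (Finset.univ ×ˢ B₂) := by
    refine Finset.exists_mem_notMem_of_card_lt_card (lt_of_le_of_lt ?_ hJ)
    refine (Finset.card_union_le _ _).trans ?_
    rw [Finset.card_product, Finset.card_product, Finset.card_univ]
    nlinarith [Nat.mul_le_mul_right (Fintype.card V) hb₁, Nat.mul_le_mul_left (Fintype.card V) hb₂]
  simp only [Finset.mem_union, Finset.mem_product, Finset.mem_univ, and_true, true_and, not_or,
    hB₁, hB₂, Finset.mem_filter] at hnot
  push Not at hnot
  obtain ⟨⟨y₁, hy₁, hay₁⟩, y₂, hy₂, hby₂⟩ := hnot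
  obtain ⟨-, Q₁, Q₂, hp, hcQ, hh, hg, hU₁, hU₂⟩ := Finset.mem_filter.1 hab
  obtain ⟨c, hcp, hcc⟩ := exists_closed_of_halves hG (hp.nodup_iff.2 hl) hcQ
    (T₁ := fun x y z => ∃ j ∈ J₁, [x, y, z] <:+: seg j)
    (T₂ := fun x y z => ∃ j ∈ J₂, [x, y, z] <:+: seg j)
    (by rintro x y z ⟨j, hj, h⟩; exact (hU₁ j hj).of_infix_block h)
    (by rintro x y z ⟨j, hj, h⟩; exact (hU₂ j hj).of_infix_block h) hX₁ hX₂ hh hg hy₁ hay₁ hy₂ hby₂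
  exact ⟨c, hcp.trans hp, hcc⟩

/-- An expander in which any two sets of `m` vertices are joined is Hamiltonian, provided the
numerical parameters leave room for the rotation argument. -/
lemma exists_isHamiltonianCycle_of_expander [DecidableEq V] {G : SimpleGraph V}
    {m s r L d k t : ℕ} (hG : SetsJoined G m)
    (hE : ∀ X : Finset V, X.card ≤ s → 9 * X.card ≤ (nbhd G X).card) (hs : 0 < s) (hms : m ≤ s)
    (hr : s ≤ 2 ^ r) (hk : 0 < k) (hd : 0 < d) (hLk : 2 * k + 2 * (r + 1) ≤ L) (ht : t ≤ k)
    (hL : L ≤ 8 * (k + 1 - t)) (htd : 21 * m ≤ t * (d - 2))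
    (hcount : 2 * m * Fintype.card V * 64 ^ t < s * s)
    (hn : L * d + m ≤ Fintype.card V) (hV : 3 ≤ Fintype.card V) :
    ∃ (v : V) (c : G.Walk v v), c.IsHamiltonianCycle := by
  have : Nonempty V := Fintype.card_pos_iff.1 (by omega)
  obtain ⟨l, hl, hc, hne, hmax⟩ := exists_longest_path G
  have hZ : l.toFinsetᶜ.card < m := by
    by_contra! hm
    obtain ⟨F, hF, hFl⟩ := exists_ends_of_longest hl hc hne hmax hs hE hr
    obtain ⟨x, hx, z, hz, hxz⟩ := hG F l.toFinsetᶜ (by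
      rw [Finset.disjoint_left]
      intro v hv hv'
      obtain ⟨l', hp, -, hh, -⟩ := hFl v hv
      simp only [Finset.mem_compl, List.mem_toFinset] at hv'
      exact hv' (hp.mem_iff.1 (List.mem_of_mem_head? hh))) (hms.trans hF) hm
    obtain ⟨l', hp, hc', hh, -⟩ := hFl x hx
    simp only [Finset.mem_compl, List.mem_toFinset] at hz
    exact hz (mem_of_adj_of_head_eq hl hmax hp hc' hh hxz)
  have hcard := Finset.card_add_card_compl l.toFinset
  rw [List.toFinset_card_of_nodup hl] at hcard
  obtain ⟨c, hcp, hcc, x, y, hx, hy, hxy⟩ := exists_closed_of_longest hG hE hs hr hk hd hLk ht hL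
    htd hcount hl hc hne hmax (by omega)
  have hall : ∀ v, v ∈ l := by
    by_contra! hcon
    obtain ⟨z, hz⟩ := hcon
    have hpos : 0 < l.toFinsetᶜ.card := Finset.card_pos.2 ⟨z, by simpa using hz⟩
    have h1 := hE l.toFinsetᶜ (by omega)
    have h2 : l.toFinsetᶜ.card < (nbhd G l.toFinsetᶜ).card := by omega
    obtain ⟨w, hw, hw'⟩ := Finset.exists_mem_notMem_of_card_lt_card h2
    obtain ⟨v, hv, hvw⟩ := mem_nbhd.1 hw
    simp only [Finset.mem_compl, List.mem_toFinset, not_not] at hv hw'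
    obtain ⟨l', h2, h3, h4⟩ := exists_longer_path (hcp.nodup_iff.2 hl) hcc hx hy hxy
      (by rwa [hcp.mem_iff]) (hcp.mem_iff.2 hw') hvw
    have := hmax l' h2 h3
    rw [h4, hcp.length_eq] at this
    omega
  refine exists_isHamiltonianCycle_of_list (hcp.nodup_iff.2 hl) hcc ?_
    (fun v => hcp.mem_iff.2 (hall v)) hx hy hxy
  have : l.toFinsetᶜ = ∅ := by
    ext v
    simp [hall v]
  rw [this, Finset.card_empty] at hcard
  rw [hcp.length_eq]
  omega

end Expanders

section Pseudorandom

variable {V : Type} [Fintype V]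

lemma sum_degree_le_two_mul_interiorEdgeCount {G : SimpleGraph V} {X : Finset V} {Y : Set V}
    (hXY : ∀ x ∈ X, x ∈ Y ∧ ∀ v, G.Adj x v → v ∈ Y) :
    ∑ x ∈ X, (G.neighborSet x).ncard ≤ 2 * interiorEdgeCount G Y := by
  classical
  have h := Finset.card_le_mul_card_image_of_maps_to (s := X.sigma fun x => G.neighborFinset x)
    (t := {e ∈ G.edgeSet | ∀ v ∈ e, v ∈ Y}.toFinset) (f := fun e => s(e.1, e.2)) (by
      rintro ⟨x, v⟩ h
      rw [Finset.mem_sigma, mem_neighborFinset] at h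
      obtain ⟨h1, h2⟩ := hXY x h.1
      simp only [Set.mem_toFinset, Set.mem_ofPred_eq, mem_edgeSet, Sym2.mem_iff]
      refine ⟨h.2, ?_⟩
      rintro w (rfl | rfl)
      exacts [h1, h2 _ h.2]) 2 (by
      intro e _
      induction e with | _ a b =>
      refine (Finset.card_le_card (t := {⟨a, b⟩, ⟨b, a⟩}) ?_).trans Finset.card_le_two
      rintro ⟨x, v⟩ h
      have h' := (Finset.mem_filter.1 h).2
      rw [Sym2.eq_iff] at h'
      rcases h' with ⟨rfl, rfl⟩ | ⟨rfl, rfl⟩ <;> simp)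
  rw [Finset.card_sigma] at h
  rw [interiorEdgeCount, Set.ncard_eq_toFinset_card']
  refine le_trans (le_of_eq ?_) h
  refine Finset.sum_congr rfl fun x _ => ?_
  rw [Set.ncard_eq_toFinset_card', neighborFinset]

/-- Small sets in a jumbled graph of large minimum degree expand. -/
lemma IsJumbled.nine_mul_card_le_card_nbhd {G : SimpleGraph V} {p β : ℝ} (h : IsJumbled G p β)
    (hβ : β ≤ p * Fintype.card V / 100)
    (hdeg : ∀ v, 9 / 10 * (p * Fintype.card V) ≤ (G.neighborSet v).ncard) {X : Finset V}
    (hX : X.card ≤ Fintype.card V / 200) : 9 * X.card ≤ (nbhd G X).card := by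
  classical
  by_contra! hlt
  obtain ⟨hp, -, hβ1, hj⟩ := h
  set n := Fintype.card V
  have hpos : 0 < X.card := by omega
  have h1 := sum_degree_le_two_mul_interiorEdgeCount (G := G) (X := X)
    (Y := ((X ∪ nbhd G X : Finset V) : Set V)) (by
      intro x hx
      simp only [Finset.coe_union, Set.mem_union, Finset.mem_coe]
      exact ⟨Or.inl hx, fun v hv => Or.inr (mem_nbhd.2 ⟨x, hx, hv⟩)⟩)
  have h2 := hj ((X ∪ nbhd G X : Finset V) : Set V)
  rw [Set.ncard_coe_finset] at h2
  have hY : (X ∪ nbhd G X).card ≤ 10 * X.card := by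
    have := Finset.card_union_le X (nbhd G X)
    omega
  set y := (X ∪ nbhd G X).card
  set E := interiorEdgeCount G ((X ∪ nbhd G X : Finset V) : Set V)
  have h3 : X.card * (9 / 10 * (p * n)) ≤ 2 * (E : ℝ) := by
    have : ((∑ x ∈ X, (G.neighborSet x).ncard : ℕ) : ℝ) ≤ 2 * (E : ℝ) := by exact_mod_cast h1
    refine le_trans ?_ this
    push_cast
    rw [← nsmul_eq_mul]
    exact Finset.card_nsmul_le_sum _ _ _ fun x _ => hdeg x
  have h4 := (abs_le.1 h2).2
  rw [Nat.cast_choose_two] at h4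
  have hx : (X.card : ℝ) ≤ n / 200 := by
    rw [le_div_iff₀ (by norm_num)]
    exact_mod_cast (Nat.le_div_iff_mul_le (by norm_num)).1 hX
  have hx0 : (0 : ℝ) < X.card := by exact_mod_cast hpos
  have hy : (y : ℝ) ≤ 10 * X.card := by exact_mod_cast hY
  have hy0 : (0 : ℝ) ≤ y := Nat.cast_nonneg _
  have h5 : p * ((y : ℝ) * (y - 1) / 2) ≤ p * n * X.card / 4 := by
    have : (y : ℝ) * (y - 1) / 2 ≤ n * X.card / 4 := by nlinarith
    calc _ ≤ p * (n * X.card / 4) := mul_le_mul_of_nonneg_left this hp.le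
      _ = _ := by ring
  have h6 : β * y ≤ p * n * X.card / 10 := by
    calc β * y ≤ (p * n / 100) * (10 * X.card) :=
          mul_le_mul hβ hy hy0 (by linarith)
      _ = _ := by ring
  have hn : (0 : ℝ) < n := by linarith
  have h7 : 0 < p * n * X.card := by positivity
  linarith

lemma two_mul_mul_pow_lt_mul_self {n m s t : ℕ} {q w : ℝ} (hq : 100 ≤ q) (hw0 : 0 < w)
    (hw : w * Real.exp q = n) (hm : m ≤ q * w / 50000) (hs : (n : ℝ) / 400 ≤ s)
    (ht : (t : ℝ) ≤ q / 10) : 2 * m * n * 64 ^ t < s * s := by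
  have hn0 : (0 : ℝ) < n := by rw [← hw]; positivity
  have hqsqrt : q ^ 2 / 8 ≤ Real.exp (q / 2) := by
    have := Real.quadratic_le_exp_of_nonneg (x := q / 2) (by linarith)
    nlinarith
  have h64 : (64 : ℝ) ^ t ≤ Real.exp (q / 2) := by
    calc (64 : ℝ) ^ t ≤ Real.exp 5 ^ t := by
          refine pow_le_pow_left₀ (by norm_num) ?_ t
          have h1 : Real.exp 5 = Real.exp 1 ^ 5 := by
            rw [← Real.exp_nat_mul]
            norm_num
          have h2 := pow_le_pow_left₀ (by norm_num) Real.exp_one_gt_d9.le 5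
          rw [h1]
          exact le_trans (by norm_num) h2
      _ = Real.exp (t * 5) := (Real.exp_nat_mul 5 t).symm
      _ ≤ _ := Real.exp_le_exp.2 (by linarith)
  have hsq : Real.exp (q / 2) * Real.exp (q / 2) = Real.exp q := by
    rw [← Real.exp_add, add_halves]
  set z := Real.exp (q / 2)
  have hz : 12 * q ≤ z := by nlinarith
  have hz0 : 0 < z := Real.exp_pos _
  have h1 : q * w * z ≤ n / 12 := by
    rw [← hw, ← hsq]
    have : 0 ≤ w * z * (z - 12 * q) := by
      have : 0 ≤ z - 12 * q := by linarith
      positivity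
    linarith
  have h2 : (2 * m * n * 64 ^ t : ℝ) ≤ n ^ 2 / 300000 := by
    calc (2 * m * n * 64 ^ t : ℝ) ≤ 2 * (q * w / 50000) * n * z := by gcongr
      _ = q * w * z * (n / 25000) := by ring
      _ ≤ n / 12 * (n / 25000) := by gcongr
      _ = _ := by ring
  have h3 : (n : ℝ) / 400 * (n / 400) ≤ s * s := mul_self_le_mul_self (by positivity) hs
  have h4 : (2 * m * n * 64 ^ t : ℝ) < s * s := by nlinarith
  exact_mod_cast h4

/-- The numerical parameters of `exists_isHamiltonianCycle_of_expander` for large `n`. -/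
lemma exists_rotation_parameters {n : ℕ} (hn : Real.exp (Real.exp 100) ≤ n) {m : ℕ}
    (hm : m = ⌈1 / 100000 * n * Real.log (Real.log n) / Real.log n⌉₊) :
    ∃ r L d k t : ℕ, 0 < n / 200 ∧ m ≤ n / 200 ∧ n / 200 ≤ 2 ^ r ∧ 0 < k ∧ 0 < d ∧
      2 * k + 2 * (r + 1) ≤ L ∧ t ≤ k ∧ L ≤ 8 * (k + 1 - t) ∧ 21 * m ≤ t * (d - 2) ∧
      2 * m * n * 64 ^ t < (n / 200) * (n / 200) ∧ L * d + m ≤ n ∧ 3 ≤ n := by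
  have hn0 : (0 : ℝ) < n := (Real.exp_pos _).trans_le hn
  set l := Real.log n with hl
  have hel : Real.exp l = n := Real.exp_log hn0
  have hl1 : Real.exp 100 ≤ l := (Real.le_log_iff_exp_le hn0).2 hn
  have hl0 : 0 < l := (Real.exp_pos _).trans_le hl1
  set q := Real.log l with hq
  have heq : Real.exp q = l := Real.exp_log hl0
  have hq1 : 100 ≤ q := (Real.le_log_iff_exp_le hl0).2 hl1
  have hql : q ^ 2 / 2 ≤ l := by
    have := Real.quadratic_le_exp_of_nonneg (x := q) (by linarith)
    linarith
  have hql' : q ≤ l := by nlinarith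
  have hl2 : 5000 ≤ l := by nlinarith
  have hln : l ^ 2 / 2 ≤ n := by
    have := Real.quadratic_le_exp_of_nonneg (x := l) (by linarith)
    linarith
  -- the rotation depth
  set R := Nat.log 2 n + 2 with hR
  have hnne : n ≠ 0 := by rintro rfl; simp at hn0
  have hR1 : n < 2 ^ (R - 1) := Nat.lt_pow_succ_log_self (by norm_num) n
  have hRl : (R : ℝ) ≤ 2 * l := by
    have h1 : ((2 : ℝ) ^ Nat.log 2 n) ≤ n := by exact_mod_cast Nat.pow_log_le_self 2 hnne
    have h2 := Real.log_le_log (by positivity) h1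
    rw [Real.log_pow] at h2
    have := Real.log_two_gt_d9
    rw [hR]
    push_cast
    nlinarith
  have hlR : l ≤ R := by
    have h1 : (n : ℝ) ≤ 2 ^ (R - 1) := by exact_mod_cast hR1.le
    have h2 := Real.log_le_log hn0 h1
    rw [Real.log_pow] at h2
    have := Real.log_two_lt_d9
    have h3 : ((R - 1 : ℕ) : ℝ) ≤ R := by exact_mod_cast Nat.sub_le _ _
    have h4 : (0 : ℝ) ≤ ((R - 1 : ℕ) : ℝ) := Nat.cast_nonneg _
    nlinarith
  have hR0 : 0 < R := by omega
  have hRr : (0 : ℝ) < R := by exact_mod_cast hR0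
  -- the ratio of `n` to its logarithm
  set w := n / l with hw
  have hwl : w * l = n := div_mul_cancel₀ _ hl0.ne'
  have hw1 : l / 2 ≤ w := by
    rw [hw, le_div_iff₀ hl0]
    linarith
  have hw0 : 0 < w := by linarith
  have hm1 : (m : ℝ) ≤ q * w / 50000 := by
    have h1 : (1 : ℝ) / 100000 * n * q / l = q * w / 100000 := by rw [hw]; ring
    rw [h1] at hm
    have h2 := Nat.ceil_lt_add_one (a := q * w / 100000) (by positivity)
    rw [← hm] at h2
    nlinarith
  have hdiv : ∀ a : ℕ, 0 < a → (n : ℝ) / a - 1 ≤ ((n / a : ℕ) : ℝ) := by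
    intro a ha
    rw [sub_le_iff_le_add, div_le_iff₀ (by exact_mod_cast ha)]
    exact_mod_cast (Nat.lt_mul_of_div_lt (Nat.lt_succ_self _) ha).le
  have hs : (n : ℝ) / 400 ≤ ((n / 200 : ℕ) : ℝ) := by
    have := hdiv 200 (by norm_num)
    push_cast at this
    nlinarith
  set s := n / 200 with hsdef
  have hqw : q * w ≤ n := by
    rw [← hwl, mul_comm]
    exact mul_le_mul_of_nonneg_left hql' hw0.le
  have hms : m ≤ s := by
    have : (m : ℝ) ≤ s := by linarith
    exact_mod_cast this
  have hn3 : 800 ≤ n := by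
    have : (800 : ℝ) ≤ n := by nlinarith
    exact_mod_cast this
  set d := n / (12 * R) with hd
  have hd1 : w / 48 ≤ (d : ℝ) - 2 := by
    have h1 := hdiv (12 * R) (by omega)
    have h2 : w / 24 ≤ (n : ℝ) / ((12 * R : ℕ) : ℝ) := by
      rw [hw, div_div]
      refine div_le_div_of_nonneg_left hn0.le (by positivity) ?_
      push_cast
      linarith
    linarith
  have hd2 : 2 < d := by
    have : (2 : ℝ) < d := by linarith
    exact_mod_cast this
  set t := ⌊q / 10⌋₊ with ht
  have ht1 : (t : ℝ) ≤ q / 10 := Nat.floor_le (by linarith)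
  have ht2 : q / 20 ≤ t := by
    have := Nat.lt_floor_add_one (q / 10)
    rw [← ht] at this
    linarith
  have htR : t ≤ R := by
    have : (t : ℝ) ≤ R := by linarith
    exact_mod_cast this
  have hLd : 12 * R * d ≤ n := Nat.mul_div_le _ _
  have htd : 21 * m ≤ t * (d - 2) := by
    have h1 : q / 20 * (w / 48) ≤ t * ((d : ℝ) - 2) :=
      mul_le_mul ht2 hd1 (by linarith) (Nat.cast_nonneg _)
    have h2 : 0 ≤ q * w := by positivity
    have h3 : (21 * m : ℝ) ≤ t * ((d : ℝ) - 2) := by linarith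
    have h4 : ((d - 2 : ℕ) : ℝ) = (d : ℝ) - 2 := by
      rw [Nat.cast_sub hd2.le]
      norm_num
    rw [← h4] at h3
    exact_mod_cast h3
  have hcount : 2 * m * n * 64 ^ t < s * s :=
    two_mul_mul_pow_lt_mul_self hq1 hw0 (by rw [heq]; exact hwl) hm1 hs ht1
  refine ⟨R - 1, 6 * R, d, 2 * R, t, by omega, hms, ?_, by omega, by omega, by omega, by omega,
    by omega, htd, hcount, ?_, by omega⟩
  · exact (Nat.div_le_self _ _).trans hR1.le
  · have h1 : 2 * (6 * R * d) ≤ n := by linarith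
    omega

end Pseudorandom

theorem pseudorandom_hamiltonian :
    ∃ ε C : ℝ, ε > 0 ∧ C > 1 ∧ ∃ N : ℕ, ∀ n : ℕ, n ≥ N →
      ∀ (V : Type) [Fintype V] [DecidableEq V] (G : SimpleGraph V),
        Fintype.card V = n →
        ∀ p : ℝ, p ≥ C * Real.log n / n →
        (∀ v : V, ((G.neighborSet v).ncard : ℝ) ≥ (1 - ε) * n * p) →
        (∃ β : ℝ, IsJumbled G p β ∧ β ≤ ε * n * p / Real.log (Real.log n)) →
        (∀ A B : Set V, Disjoint A B →
          (A.ncard : ℝ) ≥ ε * n * Real.log (Real.log n) / Real.log n →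
          (B.ncard : ℝ) ≥ ε * n * Real.log (Real.log n) / Real.log n →
          ∃ a ∈ A, ∃ b ∈ B, G.Adj a b) →
        ∃ (x : V) (c : G.Walk x x), c.IsHamiltonianCycle := by
  refine ⟨1 / 100000, 2, by norm_num, by norm_num, ⌈Real.exp (Real.exp 100)⌉₊, ?_⟩
  rintro n hn V _ _ G rfl p - hdeg ⟨β, hj, hβ⟩ hjoin
  replace hn := Nat.ceil_le.1 hn
  obtain ⟨r, L, d, k, t, h1, h2, h3, h4, h5, h6, h7, h8, h9, h10, h11, h12⟩ :=
    exists_rotation_parameters hn rfl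
  have hnp : 0 ≤ p * Fintype.card V := mul_nonneg hj.1.le (Nat.cast_nonneg _)
  refine exists_isHamiltonianCycle_of_expander (fun A B hAB hA hB => ?_) (fun X hX => ?_) h1 h2 h3
    h4 h5 h6 h7 h8 h9 h10 h11 h12
  · obtain ⟨a, ha, b, hb, hab⟩ := hjoin A B (Finset.disjoint_coe.2 hAB)
      (by rw [Set.ncard_coe_finset]; exact Nat.ceil_le.1 hA)
      (by rw [Set.ncard_coe_finset]; exact Nat.ceil_le.1 hB)
    exact ⟨a, ha, b, hb, hab⟩
  · have hn0 : (0 : ℝ) < Fintype.card V := (Real.exp_pos _).trans_le hn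
    have hl1 := (Real.le_log_iff_exp_le hn0).2 hn
    have hq1 := (Real.le_log_iff_exp_le ((Real.exp_pos _).trans_le hl1)).2 hl1
    refine hj.nine_mul_card_le_card_nbhd (hβ.trans ?_) (fun v => (?_ : _ ≤ _).trans (hdeg v)) hX
    · rw [div_le_iff₀ (by linarith)]
      nlinarith
    · nlinarith
end

section
/- Let H be a connected simple graph on n vertices with minimum degree strictly greater than n/4. Then any two vertices of H are joined by a path of length at most 9; in particular, the diameter of H is at most 9. -/
open SimpleGraph

theorem SimpleGraph.Connected.exists_dist_eq {V : Type*} {G : SimpleGraph V} (hG : G.Connected)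
    {x y : V} {i : ℕ} (hi : i ≤ G.dist x y) : ∃ v, G.dist x v = i := by
  obtain ⟨p, hp⟩ := hG.exists_walk_length_eq_dist x y
  refine ⟨p.getVert i, ?_⟩
  have h₁ := dist_le (p.take i)
  have h₂ := dist_le (p.drop i)
  have h₃ := hG.dist_triangle (u := x) (v := p.getVert i) (w := y)
  rw [Walk.take_length] at h₁
  rw [Walk.drop_length] at h₂
  omega

/-- Neighborhoods of vertices whose distances from `x` differ by at least three are disjoint. -/
theorem SimpleGraph.Connected.disjoint_neighborSet_of_dist_add_three_le {V : Type*}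
    {G : SimpleGraph V} (hG : G.Connected) {x u v : V} (h : G.dist x u + 3 ≤ G.dist x v) :
    Disjoint (G.neighborSet u) (G.neighborSet v) := by
  refine Set.disjoint_left.2 fun z hu hv => ?_
  have h₁ := hG.dist_triangle (u := x) (v := u) (w := z)
  have h₂ := hG.dist_triangle (u := x) (v := z) (w := v)
  rw [dist_eq_one_iff_adj.2 hu] at h₁
  rw [dist_eq_one_iff_adj.2 (G.adj_symm hv)] at h₂
  omega

/-- If every degree exceeds `|V| / k`, then a connected graph has no two vertices at distance
`3 * (k - 1)` or more. -/
theorem SimpleGraph.Connected.dist_add_three_lt_of_card_lt_mul_degree {V : Type*} [Fintype V]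
    {G : SimpleGraph V} (hG : G.Connected) {k : ℕ}
    (hdeg : ∀ v, Fintype.card V < k * (G.neighborSet v).ncard) (x y : V) :
    G.dist x y + 3 < 3 * k := by
  classical
  by_contra! hxy
  have : Nonempty V := ⟨x⟩
  choose! f hf using fun i (hi : i < k) =>
    hG.exists_dist_eq (x := x) (y := y) (i := 3 * i) (by omega)
  have hdisj : (Finset.range k : Set ℕ).PairwiseDisjoint fun i => (G.neighborFinset (f i)) := by
    intro i hi j hj hij
    have hi := hf i (by simpa using hi)
    have hj := hf j (by simpa using hj)
    simp only [Function.onFun, ← Finset.disjoint_coe, coe_neighborFinset]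
    rcases lt_or_gt_of_ne hij with h | h
    · exact hG.disjoint_neighborSet_of_dist_add_three_le (x := x) (by omega)
    · exact (hG.disjoint_neighborSet_of_dist_add_three_le (x := x) (by omega)).symm
  have hcard := Finset.card_biUnion hdisj
  have hle := Finset.card_le_univ ((Finset.range k).biUnion fun i => G.neighborFinset (f i))
  have hk : k ≠ 0 := by
    rintro rfl
    simpa using hdeg x
  have hlt : ∑ i ∈ Finset.range k, Fintype.card V
      < ∑ i ∈ Finset.range k, k * (G.neighborFinset (f i)).card := by
    refine Finset.sum_lt_sum_of_nonempty (by simpa using hk) fun i _ => ?_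
    simpa [← coe_neighborFinset, Set.ncard_coe_finset] using hdeg (f i)
  rw [Finset.sum_const, Finset.card_range, smul_eq_mul, ← Finset.mul_sum, ← hcard] at hlt
  exact absurd (Nat.lt_of_mul_lt_mul_left hlt) hle.not_gt

theorem diameter_le_nine {V : Type} [Fintype V] [DecidableEq V]
    (H : SimpleGraph V) (n : ℕ) (hn : Fintype.card V = n)
    (hconn : H.Connected)
    (hdeg : ∀ v : V, ((H.neighborSet v).ncard : ℝ) > n / 4) :
    (∀ x y : V, ∃ w : H.Walk x y, w.IsPath ∧ w.length ≤ 9) ∧ H.ediam ≤ 9 := by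
  have hdeg' (v : V) : Fintype.card V < 4 * (H.neighborSet v).ncard := by
    have h := hdeg v
    rw [gt_iff_lt, div_lt_iff₀' (by norm_num)] at h
    rw [hn]
    exact_mod_cast h
  have hdist (x y : V) : H.dist x y ≤ 9 := by
    have := hconn.dist_add_three_lt_of_card_lt_mul_degree hdeg' x y
    omega
  refine ⟨fun x y => ?_, ediam_le_of_edist_le fun x y => ?_⟩
  · obtain ⟨w, hw, hlen⟩ := hconn.exists_path_of_dist x y
    exact ⟨w, hw, hlen.trans_le (hdist x y)⟩
  · rw [← (hconn x y).coe_dist_eq_edist]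
    exact_mod_cast hdist x y
end
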